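/- Let p ∈ (0,1) with p ≠ 1/2 and let (S_n, K_n)_{n≥0} be a random trie pair family with parameter p. Then the Pearson correlation coefficient ρ(S_n, K_n) = Cov(S_n, K_n)/√(Var(S_n)·Var(K_n)) tends to 0 as n → ∞. -/

import Mathlib

open MeasureTheory ProbabilityTheory Filter Topology

noncomputable def binomialMeasure (n : ℕ) (p : ℝ) : Measure ℕ :=
  ∑ k ∈ Finset.range (n + 1),
    (ENNReal.ofReal ((n.choose k : ℝ) * p ^ k * (1 - p) ^ (n - k))) • Measure.dirac k

/-- The combination map `(B, (S',K')_j, (S'',K'')_j) ↦ (S'_B + S''_{n-B} + 1, K'_B + K''_{n-B} + n)`. -/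
def trieStep (n : ℕ) (ω : ℕ × ((ℕ → ℕ × ℕ) × (ℕ → ℕ × ℕ))) : ℕ × ℕ :=
  ((ω.2.1 ω.1).1 + (ω.2.2 (n - ω.1)).1 + 1,
   (ω.2.1 ω.1).2 + (ω.2.2 (n - ω.1)).2 + n)

/-- A random trie pair family with parameter `p`, given by the joint laws
`μ n` of `(S_n, K_n)` on `ℕ × ℕ`. -/
structure IsTriePairFamily (p : ℝ) (μ : ℕ → Measure (ℕ × ℕ)) : Prop where
  prob : ∀ n, IsProbabilityMeasure (μ n)
  moments : ∀ n r : ℕ, Integrable (fun x : ℕ × ℕ => ((x.1 : ℝ) + (x.2 : ℝ)) ^ r) (μ n)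
  init0 : μ 0 = Measure.dirac (0, 0)
  init1 : μ 1 = Measure.dirac (0, 0)
  recur : ∀ n, 2 ≤ n → ∃ P : Measure (ℕ × ((ℕ → ℕ × ℕ) × (ℕ → ℕ × ℕ))),
    IsProbabilityMeasure P ∧
    P.map Prod.fst = binomialMeasure n p ∧
    (∀ j, P.map (fun ω => ω.2.1 j) = μ j) ∧
    (∀ j, P.map (fun ω => ω.2.2 j) = μ j) ∧
    P = (P.map Prod.fst).prod
          ((P.map (fun ω => ω.2.1)).prod (P.map (fun ω => ω.2.2))) ∧
    μ n = P.map (trieStep n)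

noncomputable def eS (μ : ℕ → Measure (ℕ × ℕ)) (n : ℕ) : ℝ := ∫ x, (x.1 : ℝ) ∂ μ n

noncomputable def eK (μ : ℕ → Measure (ℕ × ℕ)) (n : ℕ) : ℝ := ∫ x, (x.2 : ℝ) ∂ μ n

noncomputable def varS (μ : ℕ → Measure (ℕ × ℕ)) (n : ℕ) : ℝ :=
  ∫ x, ((x.1 : ℝ) - eS μ n) ^ 2 ∂ μ n

noncomputable def varK (μ : ℕ → Measure (ℕ × ℕ)) (n : ℕ) : ℝ :=
  ∫ x, ((x.2 : ℝ) - eK μ n) ^ 2 ∂ μ n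

noncomputable def covSK (μ : ℕ → Measure (ℕ × ℕ)) (n : ℕ) : ℝ :=
  ∫ x, ((x.1 : ℝ) - eS μ n) * ((x.2 : ℝ) - eK μ n) ∂ μ n

/-- The expectation of `f` under the binomial law with `n` trials, success probability `p` and
failure probability `q`, defined by conditioning on the first trial. -/
noncomputable def binE (p q : ℝ) : ℕ → (ℕ → ℝ) → ℝ
  | 0, f => f 0
  | n + 1, f => p * binE p q n (fun k => f (k + 1)) + q * binE p q n f

section Binomial

variable {p q : ℝ}

theorem binE_zero (f : ℕ → ℝ) : binE p q 0 f = f 0 := rfl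

theorem binE_succ (n : ℕ) (f : ℕ → ℝ) :
    binE p q (n + 1) f = p * binE p q n (fun k => f (k + 1)) + q * binE p q n f := rfl

theorem binE_congr {n : ℕ} {f g : ℕ → ℝ} (h : ∀ k ≤ n, f k = g k) :
    binE p q n f = binE p q n g := by
  induction n generalizing f g with
  | zero => exact h 0 le_rfl
  | succ n ih =>
    rw [binE_succ, binE_succ, ih (fun k hk => h (k + 1) (by omega)),
      ih (fun k hk => h k (by omega))]

theorem binE_add (n : ℕ) (f g : ℕ → ℝ) :
    binE p q n (fun k => f k + g k) = binE p q n f + binE p q n g := by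
  induction n generalizing f g with
  | zero => rfl
  | succ n ih => rw [binE_succ, binE_succ, binE_succ, ih, ih]; ring

theorem binE_mul_left (n : ℕ) (c : ℝ) (f : ℕ → ℝ) :
    binE p q n (fun k => c * f k) = c * binE p q n f := by
  induction n generalizing f with
  | zero => rfl
  | succ n ih => rw [binE_succ, binE_succ, ih, ih]; ring

theorem binE_sub (n : ℕ) (f g : ℕ → ℝ) :
    binE p q n (fun k => f k - g k) = binE p q n f - binE p q n g := by
  have h := binE_add (p := p) (q := q) n f (fun k => (-1) * g k)
  rw [binE_mul_left] at h
  rw [show (fun k => f k - g k) = fun k => f k + (-1) * g k from funext fun k => by ring, h]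
  ring

theorem binE_const (hpq : p + q = 1) (n : ℕ) (c : ℝ) : binE p q n (fun _ => c) = c := by
  induction n with
  | zero => rfl
  | succ n ih => rw [binE_succ, ih, ← add_mul, hpq, one_mul]

theorem binE_nonneg (hp : 0 ≤ p) (hq : 0 ≤ q) {n : ℕ} {f : ℕ → ℝ} (h : ∀ k ≤ n, 0 ≤ f k) :
    0 ≤ binE p q n f := by
  induction n generalizing f with
  | zero => exact h 0 le_rfl
  | succ n ih =>
    rw [binE_succ]
    have h1 := ih (f := fun k => f (k + 1)) (fun k hk => h (k + 1) (by omega))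
    have h2 := ih (f := f) (fun k hk => h k (by omega))
    positivity

theorem binE_mono (hp : 0 ≤ p) (hq : 0 ≤ q) {n : ℕ} {f g : ℕ → ℝ} (h : ∀ k ≤ n, f k ≤ g k) :
    binE p q n f ≤ binE p q n g := by
  have := binE_nonneg hp hq (n := n) (f := fun k => g k - f k) (fun k hk => sub_nonneg.2 (h k hk))
  rw [binE_sub] at this
  linarith

theorem abs_binE_le (hp : 0 ≤ p) (hq : 0 ≤ q) (n : ℕ) (f : ℕ → ℝ) :
    |binE p q n f| ≤ binE p q n (fun k => |f k|) := by
  rw [abs_le]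
  constructor
  · have := binE_mono hp hq (n := n) (f := fun k => (-1) * |f k|) (g := f)
      (fun k _ => by linarith [neg_abs_le (f k)])
    rw [binE_mul_left] at this
    linarith
  · exact binE_mono hp hq fun k _ => le_abs_self _

theorem binE_reflect (n : ℕ) (f : ℕ → ℝ) :
    binE p q n (fun k => f (n - k)) = binE q p n f := by
  induction n generalizing f with
  | zero => rfl
  | succ n ih =>
    rw [binE_succ, binE_succ, ← ih f, ← ih (fun k => f (k + 1)), add_comm]
    congr 2
    · exact binE_congr fun k hk => by rw [Nat.sub_add_comm hk]
    · exact binE_congr fun k hk => by rw [Nat.add_sub_add_right]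

theorem binE_eq_sum (n : ℕ) (f : ℕ → ℝ) :
    binE p q n f = ∑ k ∈ Finset.range (n + 1), (n.choose k : ℝ) * p ^ k * q ^ (n - k) * f k := by
  rw [← Finset.Nat.sum_antidiagonal_eq_sum_range_succ
    (fun i j => (n.choose i : ℝ) * p ^ i * q ^ j * f i)]
  induction n generalizing f with
  | zero => simp [binE_zero]
  | succ n ih =>
    have h := Finset.sum_antidiagonal_choose_succ_mul (fun i j => p ^ i * q ^ j * f i) n
    simp only [← mul_assoc] at h
    rw [h, binE_succ, ih, ih, Finset.mul_sum, Finset.mul_sum, add_comm]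
    congr 1
    · exact Finset.sum_congr rfl fun x _ => by ring
    · refine Finset.sum_congr rfl fun x hx => ?_
      rw [Finset.HasAntidiagonal.mem_antidiagonal] at hx
      rw [Nat.choose_symm_of_eq_add hx.symm]
      ring

theorem le_binE (hp : 0 ≤ p) (hq : 0 ≤ q) {n j : ℕ} (hj : j ≤ n) {f : ℕ → ℝ}
    (h : ∀ k ≤ n, 0 ≤ f k) :
    (n.choose j : ℝ) * p ^ j * q ^ (n - j) * f j ≤ binE p q n f := by
  rw [binE_eq_sum]
  refine Finset.single_le_sum (f := fun k => (n.choose k : ℝ) * p ^ k * q ^ (n - k) * f k)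
    (fun k hk => ?_) (Finset.mem_range.2 (by omega))
  have := h k (by simp at hk; omega)
  positivity

theorem binE_le_self_term (hp : 0 ≤ p) (hq : 0 ≤ q) {n : ℕ} {f : ℕ → ℝ}
    (h : ∀ k < n, f k ≤ 0) : binE p q n f ≤ p ^ n * f n := by
  rw [binE_eq_sum, Finset.sum_range_succ]
  have : ∑ k ∈ Finset.range n, (n.choose k : ℝ) * p ^ k * q ^ (n - k) * f k ≤ 0 :=
    Finset.sum_nonpos fun k hk =>
      mul_nonpos_of_nonneg_of_nonpos (by positivity) (h k (Finset.mem_range.1 hk))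
  simpa using this

theorem binE_mul_self (n : ℕ) (f : ℕ → ℝ) :
    binE p q (n + 1) (fun k => k * f k) = (n + 1) * p * binE p q n (fun k => f (k + 1)) := by
  induction n generalizing f with
  | zero => simp [binE_succ, binE_zero]
  | succ n ih =>
    rw [binE_succ, ih f]
    have h1 : binE p q (n + 1) (fun k => ((k + 1 : ℕ) : ℝ) * f (k + 1)) =
        (n + 1) * p * binE p q n (fun k => f (k + 1 + 1)) +
          binE p q (n + 1) (fun k => f (k + 1)) := by
      rw [← ih (fun k => f (k + 1)), ← binE_add]
      exact binE_congr fun k _ => by push_cast; ring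
    rw [h1, binE_succ n (fun k => f (k + 1))]
    push_cast
    ring

theorem binE_id (hpq : p + q = 1) (n : ℕ) : binE p q n (fun k => (k : ℝ)) = n * p := by
  cases n with
  | zero => simp [binE_zero]
  | succ n =>
    have := binE_mul_self (p := p) (q := q) n (fun _ => 1)
    rw [binE_const hpq] at this
    simpa using this

theorem binE_sq (hpq : p + q = 1) (n : ℕ) :
    binE p q n (fun k => (k : ℝ) ^ 2) = n * p * q + (n * p) ^ 2 := by
  cases n with
  | zero => simp [binE_zero]
  | succ n =>
    have h := binE_mul_self (p := p) (q := q) n (fun k => (k : ℝ))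
    have h2 : binE p q n (fun k => ((k + 1 : ℕ) : ℝ)) = n * p + 1 := by
      push_cast
      rw [binE_add, binE_id hpq, binE_const hpq]
    rw [h2] at h
    simp only [pow_two]
    rw [h]
    push_cast
    linear_combination (-(n + 1) * p) * hpq

theorem binE_sq_dev (hpq : p + q = 1) (n : ℕ) :
    binE p q n (fun k => ((k : ℝ) - n * p) ^ 2) = n * p * q := by
  have : (fun k : ℕ => ((k : ℝ) - n * p) ^ 2) =
      fun k : ℕ => ((k : ℝ) ^ 2 - (2 * (n * p)) * k) + (n * p) ^ 2 := by
    funext k; ring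
  rw [this, binE_add, binE_sub, binE_mul_left, binE_sq hpq, binE_id hpq, binE_const hpq]
  ring

theorem binE_abs_dev_le (hp : 0 ≤ p) (hq : 0 ≤ q) (hpq : p + q = 1) (n : ℕ) :
    binE p q n (fun k => |(k : ℝ) - n * p|) ≤ √n := by
  rcases Nat.eq_zero_or_pos n with rfl | hn
  · simp [binE_zero]
  have hs : 0 < √(n : ℝ) := by positivity
  have hss : √(n : ℝ) * √n = n := Real.mul_self_sqrt (by positivity)
  have h := binE_mono hp hq (n := n) (f := fun k => (2 * √(n : ℝ)) * |(k : ℝ) - n * p|)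
    (g := fun k => ((k : ℝ) - n * p) ^ 2 + n) (fun k _ => by
      nlinarith [sq_nonneg (|(k : ℝ) - n * p| - √n), sq_abs ((k : ℝ) - n * p)])
  rw [binE_mul_left, binE_add, binE_sq_dev hpq, binE_const hpq] at h
  have h1 : (n : ℝ) * p * q ≤ n := by
    have : p * q ≤ 1 := by nlinarith
    have hn0 : (0 : ℝ) ≤ n := by positivity
    nlinarith
  have : 2 * √(n : ℝ) * binE p q n (fun k => |(k : ℝ) - n * p|) ≤ 2 * √(n : ℝ) * √n := by
    nlinarith
  exact le_of_mul_le_mul_left this (by positivity)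

theorem binE_ite_zero (n : ℕ) : binE p q n (fun k => if k = 0 then (1 : ℝ) else 0) = q ^ n := by
  rw [binE_eq_sum]
  simp

theorem binE_inv_succ (hp : 0 < p) (hpq : p + q = 1) (n : ℕ) :
    binE p q n (fun k => 1 / ((k : ℝ) + 1)) = (1 - q ^ (n + 1)) / (p * (n + 1)) := by
  have h := binE_mul_self (p := p) (q := q) n (fun k => 1 / (k : ℝ))
  have h2 : binE p q (n + 1) (fun k => (k : ℝ) * (1 / (k : ℝ))) = 1 - q ^ (n + 1) := by
    rw [← binE_ite_zero (p := p) (n + 1)]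
    nth_rw 2 [← binE_const hpq (n + 1) 1]
    rw [← binE_sub]
    refine binE_congr fun k _ => ?_
    rcases Nat.eq_zero_or_pos k with rfl | hk
    · simp
    · simp [hk.ne']
  rw [h2] at h
  push_cast at h
  rw [h]
  field_simp

theorem binE_comm (hpq : p + q = 1) (n : ℕ) (f : ℕ → ℝ) :
    binE p q n (fun m => binE q p m f) = binE q p n (fun m => binE p q m f) := by
  induction n generalizing f with
  | zero => rfl
  | succ n ih =>
    simp only [binE_succ, binE_add, binE_mul_left, ih]
    linear_combination (p - q) * (binE q p n fun m => binE p q m f) * hpq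

/-- Comparison principle for the recursions satisfied by additive functionals of tries. -/
theorem nonpos_of_le_binE (hp : 0 ≤ p) (hq : 0 ≤ q) {c₁ c₂ : ℝ} (hc₁ : 0 ≤ c₁) (hc₂ : 0 ≤ c₂)
    {M : ℕ} {w : ℕ → ℝ} (hself : ∀ n, M < n → c₁ * p ^ n + c₂ * q ^ n < 1)
    (hbase : ∀ n ≤ M, w n ≤ 0)
    (hstep : ∀ n, M < n → w n ≤ c₁ * binE p q n w + c₂ * binE q p n w) (n : ℕ) : w n ≤ 0 := by
  induction n using Nat.strong_induction_on with
  | _ n ih =>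
    rcases le_or_gt n M with h | h
    · exact hbase n h
    · have h1 := mul_le_mul_of_nonneg_left (binE_le_self_term hp hq ih) hc₁
      have h2 := mul_le_mul_of_nonneg_left (binE_le_self_term hq hp ih) hc₂
      have h3 := hstep n h
      have h4 := hself n h
      by_contra! hw
      nlinarith

/-- Taking differences in a trie recursion. -/
theorem diff_recursion (hpq : p + q = 1) {c₁ c₂ : ℝ} {x t : ℕ → ℝ}
    (h : ∀ n, x n = t n + c₁ * binE p q n x + c₂ * binE q p n x) (n : ℕ) :
    x (n + 1) - x n = (t (n + 1) - t n) + c₁ * p * binE p q n (fun k => x (k + 1) - x k)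
      + c₂ * q * binE q p n (fun k => x (k + 1) - x k) := by
  have h1 := h (n + 1)
  rw [binE_succ, binE_succ] at h1
  rw [binE_sub, binE_sub]
  linear_combination h1 - h n + (c₁ * binE p q n x + c₂ * binE q p n x) * hpq

end Binomial

section Variance

variable {p q : ℝ}

/-- The variance of `g` under the binomial law. -/
noncomputable def binVar (p q : ℝ) (n : ℕ) (g : ℕ → ℝ) : ℝ :=
  binE p q n (fun k => g k ^ 2) - binE p q n g ^ 2

theorem binE_sub_mul_sub (hpq : p + q = 1) (n : ℕ) (f g : ℕ → ℝ) (a b : ℝ) :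
    binE p q n (fun k => (f k - a) * (g k - b)) =
      binE p q n (fun k => f k * g k) - a * binE p q n g - b * binE p q n f + a * b := by
  rw [show (fun k => (f k - a) * (g k - b)) =
      fun k => ((f k * g k - a * g k) - b * f k) + a * b from funext fun k => by ring,
    binE_add, binE_sub, binE_sub, binE_mul_left, binE_mul_left, binE_const hpq]

theorem binVar_eq (hpq : p + q = 1) (n : ℕ) (g : ℕ → ℝ) :
    binVar p q n g = binE p q n (fun k => (g k - binE p q n g) ^ 2) := by
  simp only [pow_two, binE_sub_mul_sub hpq, binVar]
  ring

theorem sq_binE_le (hp : 0 ≤ p) (hq : 0 ≤ q) (hpq : p + q = 1) (n : ℕ) (g : ℕ → ℝ) :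
    binE p q n g ^ 2 ≤ binE p q n (fun k => g k ^ 2) := by
  have h := binVar_eq hpq n g
  have h2 : 0 ≤ binE p q n (fun k => (g k - binE p q n g) ^ 2) :=
    binE_nonneg hp hq fun k _ => sq_nonneg _
  rw [binVar] at h
  linarith

theorem binVar_succ (hpq : p + q = 1) (n : ℕ) (g : ℕ → ℝ) :
    binVar p q (n + 1) g = p * binVar p q n (fun k => g (k + 1)) + q * binVar p q n g +
      p * q * binE p q n (fun k => g (k + 1) - g k) ^ 2 := by
  simp only [binVar, binE_succ, binE_sub]
  obtain rfl : q = 1 - p := by linarith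
  ring

/-- The Poincaré inequality for the binomial law. -/
theorem binVar_le (hp : 0 ≤ p) (hq : 0 ≤ q) (hpq : p + q = 1) (n : ℕ) (g : ℕ → ℝ) :
    binVar p q (n + 1) g ≤
      (n + 1) * (p * q) * binE p q n (fun k => (g (k + 1) - g k) ^ 2) := by
  induction n generalizing g with
  | zero =>
    rw [binVar_succ hpq]
    simp [binVar, binE_zero]
  | succ n ih =>
    rw [binVar_succ hpq]
    have h1 := mul_le_mul_of_nonneg_left (ih (fun k => g (k + 1))) hp
    have h2 := mul_le_mul_of_nonneg_left (ih g) hq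
    have h3 := sq_binE_le hp hq hpq (n + 1) (fun k => g (k + 1) - g k)
    have h4 := mul_le_mul_of_nonneg_left h3 (mul_nonneg hp hq)
    have h5 := binE_succ (p := p) (q := q) n (fun k => (g (k + 1) - g k) ^ 2)
    push_cast
    rw [h5] at h4 ⊢
    nlinarith

theorem le_binVar (hp : 0 ≤ p) (hq : 0 ≤ q) (hpq : p + q = 1) (n : ℕ) (g : ℕ → ℝ) :
    (n + 1) * (p * q) * binE p q n (fun k => g (k + 1) - g k) ^ 2 ≤ binVar p q (n + 1) g := by
  induction n generalizing g with
  | zero =>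
    rw [binVar_succ hpq]
    simp [binVar, binE_zero]
  | succ n ih =>
    rw [binVar_succ hpq]
    have h1 := mul_le_mul_of_nonneg_left (ih (fun k => g (k + 1))) hp
    have h2 := mul_le_mul_of_nonneg_left (ih g) hq
    have h5 := binE_succ (p := p) (q := q) n (fun k => g (k + 1) - g k)
    set x := binE p q n (fun k => g (k + 1 + 1) - g (k + 1)) with hx
    set y := binE p q n (fun k => g (k + 1) - g k) with hy
    have h3 : (p * x + q * y) ^ 2 ≤ p * x ^ 2 + q * y ^ 2 := by
      obtain rfl : q = 1 - p := by linarith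
      nlinarith [mul_nonneg (mul_nonneg hp hq) (sq_nonneg (x - y))]
    rw [h5]
    have h6 := mul_le_mul_of_nonneg_left h3
      (mul_nonneg (by positivity : (0 : ℝ) ≤ (n : ℝ) + 1) (mul_nonneg hp hq))
    push_cast
    nlinarith

end Variance

section Recursions

variable {p q : ℝ}

theorem binE_inv_le (hp : 0 < p) (hq : 0 < q) (hpq : p + q = 1) (n : ℕ) :
    binE p q n (fun k => 1 / ((k : ℝ) + 1)) ≤ 1 / (p * (n + 1)) := by
  rw [binE_inv_succ hp hpq]
  gcongr
  linarith [pow_pos hq (n + 1)]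

theorem mul_pow_add_lt_one (hp : 0 < p) (hq : 0 < q) (hpq : p + q = 1) {n : ℕ} (hn : 1 ≤ n) :
    p * p ^ n + q * q ^ n < 1 := by
  have h1 : p ^ n ≤ p := pow_le_of_le_one hp.le (by linarith) (by omega)
  have h2 : q ^ n ≤ q := pow_le_of_le_one hq.le (by linarith) (by omega)
  nlinarith [mul_pos hp hq]

theorem pow_add_pow_lt_one (hp : 0 < p) (hq : 0 < q) (hpq : p + q = 1) {n : ℕ} (hn : 2 ≤ n) :
    p ^ n + q ^ n < 1 := by
  obtain ⟨m, rfl⟩ : ∃ m, n = m + 1 := ⟨n - 1, by omega⟩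
  rw [pow_succ', pow_succ']
  exact mul_pow_add_lt_one hp hq hpq (by omega)

/-- Solutions of the first difference recursion are bounded. -/
theorem exists_abs_le_of_recursion (hp : 0 < p) (hq : 0 < q) (hpq : p + q = 1) {d t : ℕ → ℝ}
    (ht : ∀ n, 2 ≤ n → t n = 0)
    (hd : ∀ n, d n = t n + p * binE p q n d + q * binE q p n d) :
    ∃ D, 0 ≤ D ∧ ∀ n, |d n| ≤ D := by
  refine ⟨|d 0| + |d 1|, by positivity, fun n => ?_⟩
  suffices h : |d n| - (|d 0| + |d 1|) ≤ 0 by linarith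
  refine nonpos_of_le_binE (p := p) (q := q) (M := 1) (c₁ := p) (c₂ := q)
    (w := fun n => |d n| - (|d 0| + |d 1|)) hp.le hq.le hp.le hq.le
    (fun n hn => mul_pow_add_lt_one hp hq hpq hn.le) (fun n hn => ?_) (fun n hn => ?_) n
  · interval_cases n
    · linarith [abs_nonneg (d 1)]
    · linarith [abs_nonneg (d 0)]
  · rw [binE_sub, binE_sub, binE_const hpq, binE_const (by linarith)]
    have h1 := mul_le_mul_of_nonneg_left (abs_binE_le hp.le hq.le n d) hp.le
    have h2 := mul_le_mul_of_nonneg_left (abs_binE_le hq.le hp.le n d) hq.le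
    have h3 := abs_add_le (p * binE p q n d) (q * binE q p n d)
    rw [abs_mul, abs_mul, abs_of_pos hp, abs_of_pos hq] at h3
    have h4 := hd n
    rw [ht n hn, zero_add] at h4
    rw [← h4] at h3
    linear_combination h3 + h1 + h2 + (|d 0| + |d 1|) * hpq

/-- Solutions of the second difference recursion decay like `1 / n`. -/
theorem exists_abs_le_div_of_recursion (hp : 0 < p) (hq : 0 < q) (hpq : p + q = 1) {s t : ℕ → ℝ}
    (ht : ∀ n, 2 ≤ n → t n = 0)
    (hs : ∀ n, s n = t n + p * p * binE p q n s + q * q * binE q p n s) :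
    ∃ C, 0 ≤ C ∧ ∀ n, |s n| ≤ C * (1 / ((n : ℝ) + 1)) := by
  refine ⟨|s 0| + 2 * |s 1|, by positivity, fun n => ?_⟩
  set C := |s 0| + 2 * |s 1| with hC
  have hC0 : 0 ≤ C := by positivity
  suffices h : |s n| - C * (1 / ((n : ℝ) + 1)) ≤ 0 by linarith
  refine nonpos_of_le_binE (p := p) (q := q) (M := 1) (c₁ := p * p) (c₂ := q * q)
    (w := fun n => |s n| - C * (1 / ((n : ℝ) + 1))) hp.le hq.le (by positivity) (by positivity)
    (fun n hn => ?_) (fun n hn => ?_) (fun n hn => ?_) n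
  · have := mul_pow_add_lt_one hp hq hpq (n := n) hn.le
    have h1 := pow_pos hp n
    have h2 := pow_pos hq n
    nlinarith [mul_pos hp h1, mul_pos hq h2]
  · interval_cases n
    · norm_num
      linarith [abs_nonneg (s 1)]
    · norm_num
      linarith [abs_nonneg (s 0)]
  · rw [binE_sub, binE_sub, binE_mul_left, binE_mul_left]
    have h1 := mul_le_mul_of_nonneg_left (abs_binE_le hp.le hq.le n s) (mul_nonneg hp.le hp.le)
    have h2 := mul_le_mul_of_nonneg_left (abs_binE_le hq.le hp.le n s) (mul_nonneg hq.le hq.le)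
    have h3 := abs_add_le (p * p * binE p q n s) (q * q * binE q p n s)
    rw [abs_mul (p * p), abs_mul (q * q), abs_of_pos (mul_pos hp hp), abs_of_pos (mul_pos hq hq)] at h3
    have h4 := hs n
    rw [ht n hn, zero_add] at h4
    rw [← h4] at h3
    have h5 := mul_le_mul_of_nonneg_left (binE_inv_le hp hq hpq n)
      (mul_nonneg hC0 (mul_nonneg hp.le hp.le))
    have h6 := mul_le_mul_of_nonneg_left (binE_inv_le hq hp (by linarith) n)
      (mul_nonneg hC0 (mul_nonneg hq.le hq.le))
    have h7 : C * (p * p) * (1 / (p * (n + 1))) + C * (q * q) * (1 / (q * (n + 1))) =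
        C * (1 / ((n : ℝ) + 1)) := by
      have : (n : ℝ) + 1 ≠ 0 := by positivity
      field_simp
      linear_combination C * hpq
    linarith

/-- A bounded almost harmonic sequence has asymptotically equal averages over both subtries. -/
theorem tendsto_binE_sub_binE (hp : 0 < p) (hq : 0 < q) (hpq : p + q = 1) {f : ℕ → ℝ} {D K : ℝ}
    (hD : ∀ n, |f n| ≤ D)
    (hK : ∀ n, |f n - p * binE p q n f - q * binE q p n f| ≤ K * (1 / ((n : ℝ) + 1))) :
    Tendsto (fun n => binE p q n f - binE q p n f) atTop (𝓝 0) := by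
  have hqp : q + p = 1 := by linarith
  have hD0 : 0 ≤ D := (abs_nonneg _).trans (hD 0)
  have hK0 : 0 ≤ K := by simpa using (abs_nonneg _).trans (hK 0)
  have hz : ∀ n : ℕ, (0 : ℝ) < 1 / ((n : ℝ) + 1) := fun n => by positivity
  have hEz : ∀ n : ℕ, binE p q n (fun k => 1 / ((k : ℝ) + 1)) ≤ 1 / p * (1 / ((n : ℝ) + 1)) :=
    fun n => (binE_inv_le hp hq hpq n).trans (le_of_eq (by field_simp))
  have hEz' : ∀ n : ℕ, binE q p n (fun k => 1 / ((k : ℝ) + 1)) ≤ 1 / q * (1 / ((n : ℝ) + 1)) :=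
    fun n => (binE_inv_le hq hp hqp n).trans (le_of_eq (by field_simp))
  have hbd : ∀ {a b : ℝ} (_ : 0 < a) (_ : 0 < b) (_ : a + b = 1) {g : ℕ → ℝ} {E : ℝ}
      (_ : ∀ n, |g n| ≤ E) (n : ℕ), |binE a b n g| ≤ E := fun ha hb hab g E hE n =>
    (abs_binE_le ha.le hb.le n g).trans
      ((binE_mono ha.le hb.le fun k _ => hE k).trans (binE_const hab n E).le)
  set φ : ℕ → ℝ := fun n => f n - p * binE p q n f - q * binE q p n f with hφ
  set δ : ℕ → ℝ := fun n => binE p q n f - binE q p n f with hδ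
  have hδD : ∀ n, |δ n| ≤ 2 * D := fun n => by
    have h1 := hbd hp hq hpq hD n
    have h2 := hbd hq hp hqp hD n
    rw [abs_le] at h1 h2 ⊢
    constructor <;> simp only [hδ] <;> linarith
  have hφδ : ∀ n, δ n - p * binE p q n δ - q * binE q p n δ = binE p q n φ - binE q p n φ := by
    intro n
    simp only [hδ, hφ, binE_sub, binE_mul_left]
    linear_combination (p + q) * binE_comm hpq n f
  have hφ1 : ∀ n, |binE p q n φ| ≤ K * (1 / p) * (1 / ((n : ℝ) + 1)) := fun n => by
    have h1 := binE_mono hp.le hq.le (n := n) fun k _ => hK k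
    rw [binE_mul_left] at h1
    have h2 := mul_le_mul_of_nonneg_left (hEz n) hK0
    have h3 := abs_binE_le hp.le hq.le n φ
    linarith
  have hφ2 : ∀ n, |binE q p n φ| ≤ K * (1 / q) * (1 / ((n : ℝ) + 1)) := fun n => by
    have h1 := binE_mono hq.le hp.le (n := n) fun k _ => hK k
    rw [binE_mul_left] at h1
    have h2 := mul_le_mul_of_nonneg_left (hEz' n) hK0
    have h3 := abs_binE_le hq.le hp.le n φ
    linarith
  set K₁ := K * (1 / p) + K * (1 / q) with hK₁
  have hK₁0 : 0 ≤ K₁ := by positivity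
  have hφδ' : ∀ n, |δ n - (p * binE p q n δ + q * binE q p n δ)| ≤ K₁ * (1 / ((n : ℝ) + 1)) :=
    fun n => by
      have h := abs_sub (binE p q n φ) (binE q p n φ)
      rw [← hφδ n, sub_sub] at h
      linarith [hφ1 n, hφ2 n]
  have hsq : ∀ {x y a b : ℝ}, |x| ≤ a → |y| ≤ a → |x - y| ≤ b → x ^ 2 ≤ y ^ 2 + 2 * a * b := by
    intro x y a b hx hy hxy
    have h1 : |x + y| ≤ 2 * a := (abs_add_le x y).trans (by linarith)
    have h2 : |(x + y) * (x - y)| ≤ 2 * a * b := by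
      rw [abs_mul]
      exact mul_le_mul h1 hxy (abs_nonneg _) ((abs_nonneg _).trans h1)
    have h3 := le_abs_self ((x + y) * (x - y))
    linarith [h2, h3, show (x + y) * (x - y) = x ^ 2 - y ^ 2 by ring]
  have hT : ∀ {g : ℕ → ℝ} {E : ℝ}, (∀ n, |g n| ≤ E) → ∀ n,
      |p * binE p q n g + q * binE q p n g| ≤ E := by
    intro g E hE n
    have h1 := hbd hp hq hpq hE n
    have h2 := hbd hq hp hqp hE n
    rw [abs_le] at h1 h2 ⊢
    obtain rfl : q = 1 - p := by linarith
    constructor <;> nlinarith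
  have hclaim : ∀ N : ℕ, ∃ C, 0 ≤ C ∧ ∀ n,
      f n ^ 2 + N * (p * q) * δ n ^ 2 ≤ D ^ 2 + C * (1 / ((n : ℝ) + 1)) := by
    intro N
    induction N with
    | zero =>
      refine ⟨0, le_rfl, fun n => ?_⟩
      have := sq_le_sq' (neg_le_of_abs_le (hD n)) (le_of_abs_le (hD n))
      simpa using this
    | succ N ih =>
      obtain ⟨C, hC, hN⟩ := ih
      refine ⟨2 * C + 2 * D * K + N * (p * q) * (4 * D * K₁), by positivity, fun n => ?_⟩
      have h1 := hsq (hD n) (hT hD n) (b := K * (1 / ((n : ℝ) + 1)))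
        (by rw [← sub_sub]; exact hK n)
      have h2 := hsq (hδD n) (hT hδD n) (hφδ' n)
      have h3 : (p * binE p q n δ + q * binE q p n δ) ^ 2 ≤
          p * binE p q n (fun k => δ k ^ 2) + q * binE q p n (fun k => δ k ^ 2) := by
        have e1 := mul_le_mul_of_nonneg_left (sq_binE_le hp.le hq.le hpq n δ) hp.le
        have e2 := mul_le_mul_of_nonneg_left (sq_binE_le hq.le hp.le hqp n δ) hq.le
        have e3 : (p * binE p q n δ + q * binE q p n δ) ^ 2 ≤
            p * binE p q n δ ^ 2 + q * binE q p n δ ^ 2 := by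
          have := mul_nonneg (mul_nonneg hp.le hq.le)
            (sq_nonneg (binE p q n δ - binE q p n δ))
          have e4 : p * binE p q n δ ^ 2 + q * binE q p n δ ^ 2 -
              (p * binE p q n δ + q * binE q p n δ) ^ 2 =
              p * q * (binE p q n δ - binE q p n δ) ^ 2 := by
            obtain rfl : q = 1 - p := by linarith
            ring
          linarith
        linarith
      have h4 : (p * binE p q n f + q * binE q p n f) ^ 2 + p * q * δ n ^ 2 ≤
          p * binE p q n (fun k => f k ^ 2) + q * binE q p n (fun k => f k ^ 2) := by
        have e1 := mul_le_mul_of_nonneg_left (sq_binE_le hp.le hq.le hpq n f) hp.le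
        have e2 := mul_le_mul_of_nonneg_left (sq_binE_le hq.le hp.le hqp n f) hq.le
        have e4 : (p * binE p q n f + q * binE q p n f) ^ 2 + p * q * δ n ^ 2 =
            p * binE p q n f ^ 2 + q * binE q p n f ^ 2 := by
          simp only [hδ]
          obtain rfl : q = 1 - p := by linarith
          ring
        linarith
      have h5 := mul_le_mul_of_nonneg_left (binE_mono hp.le hq.le (n := n) fun k _ => hN k) hp.le
      have h6 := mul_le_mul_of_nonneg_left (binE_mono hq.le hp.le (n := n) fun k _ => hN k) hq.le
      rw [binE_add, binE_add, binE_mul_left, binE_mul_left, binE_const hpq] at h5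
      rw [binE_add, binE_add, binE_mul_left, binE_mul_left, binE_const hqp] at h6
      have h7 := mul_le_mul_of_nonneg_left (hEz n) (mul_nonneg hp.le hC)
      have h8 := mul_le_mul_of_nonneg_left (hEz' n) (mul_nonneg hq.le hC)
      have h9 : p * C * (1 / p * (1 / ((n : ℝ) + 1))) = C * (1 / ((n : ℝ) + 1)) := by field_simp
      have h10 : q * C * (1 / q * (1 / ((n : ℝ) + 1))) = C * (1 / ((n : ℝ) + 1)) := by field_simp
      have h11 := mul_le_mul_of_nonneg_left (h2.trans (add_le_add_left h3 _))
        (mul_nonneg (Nat.cast_nonneg N : (0 : ℝ) ≤ N) (mul_nonneg hp.le hq.le))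
      have h12 : p * D ^ 2 + q * D ^ 2 = D ^ 2 := by rw [← add_mul, hpq, one_mul]
      push_cast
      linarith
  rw [Metric.tendsto_atTop]
  intro ε hε
  obtain ⟨N, hN⟩ := exists_nat_gt ((D ^ 2 + 1) / (p * q * ε ^ 2))
  have hpq0 : 0 < p * q * ε ^ 2 := by positivity
  rw [div_lt_iff₀ hpq0] at hN
  obtain ⟨C, hC, hCN⟩ := hclaim N
  obtain ⟨m, hm⟩ := exists_nat_gt C
  refine ⟨m, fun n hn => ?_⟩
  have hnm : (m : ℝ) ≤ n := by exact_mod_cast hn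
  have h1 : C * (1 / ((n : ℝ) + 1)) ≤ 1 := by
    rw [mul_one_div, div_le_one (by positivity)]
    linarith
  have h2 := hCN n
  rw [Real.dist_eq, sub_zero]
  have h3 : N * (p * q) * δ n ^ 2 < N * (p * q) * ε ^ 2 := by nlinarith [sq_nonneg (f n)]
  have h4 : δ n ^ 2 < ε ^ 2 := lt_of_mul_lt_mul_left h3 (by positivity)
  exact abs_lt_of_sq_lt_sq h4 hε.le

end Recursions

section Growth

variable {p q : ℝ}

theorem exists_pos_mul_le {V : ℕ → ℝ} (hV : ∀ n, 2 ≤ n → 0 < V n) (N : ℕ) :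
    ∃ c, 0 < c ∧ ∀ n, 2 ≤ n → n ≤ N → c * ((n : ℝ) + 1) ≤ V n := by
  induction N with
  | zero => exact ⟨1, one_pos, fun n h1 h2 => by omega⟩
  | succ N ih =>
    obtain ⟨c, hc, h⟩ := ih
    by_cases hN : 2 ≤ N + 1
    · refine ⟨min c (V (N + 1) / ((N : ℝ) + 2)),
        lt_min hc (div_pos (hV _ hN) (by positivity)), fun n h1 h2 => ?_⟩
      rcases Nat.lt_or_ge n (N + 1) with h3 | h3
      · exact (mul_le_mul_of_nonneg_right (min_le_left _ _) (by positivity)).trans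
          (h n h1 (by omega))
      · obtain rfl : n = N + 1 := by omega
        refine (mul_le_mul_of_nonneg_right (min_le_right _ _) (by positivity)).trans (le_of_eq ?_)
        push_cast
        field_simp
        ring
    · exact ⟨c, hc, fun n h1 h2 => by omega⟩

/-- Supersolutions of the trie recursion grow at least linearly. -/
theorem exists_linear_le (hp : 0 < p) (hq : 0 < q) (hpq : p + q = 1) {V : ℕ → ℝ}
    (hV0 : ∀ n, 0 ≤ V n) (hV2 : 0 < V 2)
    (hV : ∀ n, 2 ≤ n → binE p q n V + binE q p n V ≤ V n) :
    ∃ c, 0 < c ∧ ∀ n : ℕ, 2 ≤ n → c * n ≤ V n := by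
  have hqp : q + p = 1 := by linarith
  have hpos : ∀ n, 2 ≤ n → 0 < V n := fun n hn => by
    have h1 := le_binE hp.le hq.le hn (f := V) fun k _ => hV0 k
    have h2 : 0 ≤ binE q p n V := binE_nonneg hq.le hp.le fun k _ => hV0 k
    have h3 : (0 : ℝ) < (n.choose 2 : ℝ) := by exact_mod_cast Nat.choose_pos hn
    have h4 : 0 < (n.choose 2 : ℝ) * p ^ 2 * q ^ (n - 2) * V 2 := by positivity
    linarith [hV n hn]
  obtain ⟨N, hN⟩ := exists_nat_ge (4 * (1 / p + 1 / q))
  obtain ⟨c, hc, hcN⟩ := exists_pos_mul_le hpos (N + 2)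
  refine ⟨c / 2, by positivity, fun n hn => ?_⟩
  have key : c * ((n : ℝ) + 1 - 4 * (1 / ((n : ℝ) + 1))) - V n ≤ 0 := by
    refine nonpos_of_le_binE (p := p) (q := q) (c₁ := 1) (c₂ := 1) (M := N + 2)
      (w := fun n => c * ((n : ℝ) + 1 - 4 * (1 / ((n : ℝ) + 1))) - V n) hp.le hq.le zero_le_one
      zero_le_one (fun n hn => ?_) (fun n hn => ?_) (fun n hn => ?_) n
    · simpa using pow_add_pow_lt_one hp hq hpq (by omega : 2 ≤ n)
    · rcases Nat.lt_or_ge n 2 with h | h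
      · interval_cases n
        · norm_num
          linarith [hV0 0]
        · norm_num
          linarith [hV0 1]
      · have h1 := hcN n h hn
        have h2 : 0 < c * (4 * (1 / ((n : ℝ) + 1))) := by positivity
        simp only [mul_sub]
        linarith
    · simp only [binE_sub, binE_mul_left, binE_add, binE_id hpq, binE_id hqp, binE_const hpq,
        binE_const hqp]
      have h1 := binE_inv_le hp hq hpq n
      have h2 := binE_inv_le hq hp hqp n
      have h3 := hV n (by omega)
      have h4 : (N : ℝ) ≤ n := by exact_mod_cast (by omega : N ≤ n)
      have h5 : 4 * (1 / (p * ((n : ℝ) + 1)) + 1 / (q * ((n : ℝ) + 1))) ≤ 1 := by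
        rw [show 4 * (1 / (p * ((n : ℝ) + 1)) + 1 / (q * ((n : ℝ) + 1))) =
          4 * (1 / p + 1 / q) / ((n : ℝ) + 1) by field_simp]
        rw [div_le_one (by positivity)]
        linarith
      have h6 : (0 : ℝ) ≤ 4 * (1 / ((n : ℝ) + 1)) := by positivity
      have h7 : (n : ℝ) + 1 - 4 * (1 / ((n : ℝ) + 1)) ≤
          (n * p + 1 - 4 * binE p q n fun k => 1 / ((k : ℝ) + 1)) +
          (n * q + 1 - 4 * binE q p n fun k => 1 / ((k : ℝ) + 1)) := by
        have h8 : (n : ℝ) * p + n * q = n := by rw [← mul_add, hpq, mul_one]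
        linarith
      have h8 := mul_le_mul_of_nonneg_left h7 hc.le
      linarith
  have h1 : (2 : ℝ) ≤ n := by exact_mod_cast hn
  have h2 : 1 / ((n : ℝ) + 1) ≤ 1 / 3 := by
    apply one_div_le_one_div_of_le <;> linarith
  have h3 := mul_le_mul_of_nonneg_left
    (show (n : ℝ) / 2 ≤ (n : ℝ) + 1 - 4 * (1 / ((n : ℝ) + 1)) by linarith) hc.le
  linarith

theorem binE_mul_log_ge (hp : 0 < p) (hq : 0 < q) (hpq : p + q = 1) {n : ℕ} (hn : 0 < n) :
    n * p * Real.log n + n * p * Real.log p ≤ binE p q n (fun k => k * Real.log k) := by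
  have hn' : (0 : ℝ) < n := by exact_mod_cast hn
  have hy : 0 < (n : ℝ) * p := by positivity
  have h : ∀ k ≤ n, (k : ℝ) * Real.log (n * p) + k - n * p ≤ k * Real.log k := fun k _ => by
    rcases Nat.eq_zero_or_pos k with rfl | hk
    · simp
      exact hy.le
    · have hk' : (0 : ℝ) < k := by exact_mod_cast hk
      have h1 := Real.log_le_sub_one_of_pos (div_pos hy hk')
      rw [Real.log_div hy.ne' hk'.ne'] at h1
      have h2 := mul_le_mul_of_nonneg_left h1 hk'.le
      have h3 : (k : ℝ) * (n * p / k - 1) = n * p - k := by field_simp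
      linarith
  have h1 := binE_mono hp.le hq.le h
  rw [binE_sub, binE_add, binE_id hpq, binE_const hpq,
    show (fun k : ℕ => (k : ℝ) * Real.log (n * p)) = fun k : ℕ => Real.log (n * p) * (k : ℝ) from
      funext fun k => mul_comm _ _, binE_mul_left, binE_id hpq,
    Real.log_mul hn'.ne' hp.ne'] at h1
  linarith

theorem entropy_pos (hp : 0 < p) (hq : 0 < q) (hpq : p + q = 1) :
    0 < -(p * Real.log p) - q * Real.log q := by
  have h1 := Real.log_neg hp (by linarith)
  have h2 := Real.log_neg hq (by linarith)
  nlinarith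

/-- With a toll of linear order, supersolutions of the trie recursion grow superlinearly. -/
theorem exists_forall_mul_le (hp : 0 < p) (hq : 0 < q) (hpq : p + q = 1) {V : ℕ → ℝ}
    (hV0 : ∀ n, 0 ≤ V n) {c : ℝ} (hc : 0 < c) {N : ℕ}
    (hV : ∀ n, N ≤ n → c * n + binE p q n V + binE q p n V ≤ V n) (A : ℝ) :
    ∃ M : ℕ, ∀ n : ℕ, M ≤ n → A * n ≤ V n := by
  have hqp : q + p = 1 := by linarith
  set h := -(p * Real.log p) - q * Real.log q with hh
  have hh0 : 0 < h := entropy_pos hp hq hpq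
  set C := c / h * Real.log (N + 2 : ℕ) with hC
  have key : ∀ n : ℕ, c / h * (n * Real.log n) - C * n - V n ≤ 0 := by
    refine nonpos_of_le_binE (p := p) (q := q) (c₁ := 1) (c₂ := 1) (M := N + 2)
      hp.le hq.le zero_le_one zero_le_one (fun n hn => ?_) (fun n hn => ?_) (fun n hn => ?_)
    · simpa using pow_add_pow_lt_one hp hq hpq (by omega : 2 ≤ n)
    · have h1 : (n : ℝ) * Real.log n ≤ n * Real.log (N + 2 : ℕ) := by
        rcases Nat.eq_zero_or_pos n with rfl | hk
        · simp
        · have : (0 : ℝ) < n := by exact_mod_cast hk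
          gcongr
      have h2 := mul_le_mul_of_nonneg_left h1 (div_pos hc hh0).le
      rw [hC]
      linarith [hV0 n]
    · simp only [binE_sub, binE_mul_left, binE_id hpq, binE_id hqp]
      have h1 := binE_mul_log_ge hp hq hpq (by omega : 0 < n)
      have h2 := binE_mul_log_ge hq hp hqp (by omega : 0 < n)
      have h3 := hV n (by omega)
      have h4 : (n : ℝ) * Real.log n - n * h ≤
          binE p q n (fun k => k * Real.log k) + binE q p n (fun k => k * Real.log k) := by
        refine le_trans (le_of_eq ?_) (add_le_add h1 h2)
        rw [hh]
        linear_combination (-(n : ℝ) * Real.log n) * hpq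
      have h5 := mul_le_mul_of_nonneg_left h4 (div_pos hc hh0).le
      have h6 : c / h * ((n : ℝ) * Real.log n - n * h) = c / h * (n * Real.log n) - c * n := by
        field_simp
      have h7 : C * ((n : ℝ) * p) + C * (n * q) = C * n := by
        linear_combination C * n * hpq
      linarith
  have hlim : Tendsto (fun n : ℕ => Real.log (n : ℝ)) atTop atTop :=
    Real.tendsto_log_atTop.comp tendsto_natCast_atTop_atTop
  obtain ⟨M, hM⟩ := eventually_atTop.1 (hlim.eventually_ge_atTop ((A + C) / (c / h)))
  refine ⟨M, fun n hn => ?_⟩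
  have h1 := hM n hn
  rw [div_le_iff₀ (div_pos hc hh0)] at h1
  have h2 := mul_le_mul_of_nonneg_right h1 (Nat.cast_nonneg (α := ℝ) n)
  have h3 := key n
  nlinarith

theorem binE_log_bounds (hp : 0 < p) (hq : 0 < q) (hpq : p + q = 1) (n : ℕ) :
    0 ≤ binE p q n (fun k => Real.log ((k : ℝ) + 1)) - Real.log ((n : ℝ) + 1) - Real.log p ∧
    p * (binE p q n (fun k => Real.log ((k : ℝ) + 1)) - Real.log ((n : ℝ) + 1) - Real.log p) ≤
      q * (1 / ((n : ℝ) + 1)) := by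
  have hn : (0 : ℝ) < (n : ℝ) + 1 := by positivity
  have hy : 0 < p * ((n : ℝ) + 1) := by positivity
  have e : binE p q n (fun k => Real.log ((k : ℝ) + 1)) - Real.log ((n : ℝ) + 1) - Real.log p =
      binE p q n (fun k => Real.log ((k : ℝ) + 1) - Real.log (p * ((n : ℝ) + 1))) := by
    rw [binE_sub, binE_const hpq, Real.log_mul hp.ne' hn.ne']
    ring
  rw [e]
  constructor
  · have h1 : ∀ k ≤ n, 1 - p * ((n : ℝ) + 1) * (1 / ((k : ℝ) + 1)) ≤
        Real.log ((k : ℝ) + 1) - Real.log (p * ((n : ℝ) + 1)) := fun k _ => by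
      have hk : (0 : ℝ) < (k : ℝ) + 1 := by positivity
      have h2 := Real.log_le_sub_one_of_pos (div_pos hy hk)
      rw [Real.log_div hy.ne' hk.ne'] at h2
      have h3 : p * ((n : ℝ) + 1) * (1 / ((k : ℝ) + 1)) = p * ((n : ℝ) + 1) / ((k : ℝ) + 1) := by
        ring
      linarith
    refine le_trans ?_ (binE_mono hp.le hq.le h1)
    rw [binE_sub, binE_mul_left, binE_const hpq, binE_inv_succ hp hpq, mul_div_cancel₀ _ hy.ne']
    linarith [pow_pos hq (n + 1)]
  · have h1 : ∀ k ≤ n, Real.log ((k : ℝ) + 1) - Real.log (p * ((n : ℝ) + 1)) ≤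
        1 / (p * ((n : ℝ) + 1)) * ((k : ℝ) + 1) - 1 := fun k _ => by
      have hk : (0 : ℝ) < (k : ℝ) + 1 := by positivity
      have h2 := Real.log_le_sub_one_of_pos (div_pos hk hy)
      rw [Real.log_div hk.ne' hy.ne'] at h2
      have h3 : 1 / (p * ((n : ℝ) + 1)) * ((k : ℝ) + 1) = ((k : ℝ) + 1) / (p * ((n : ℝ) + 1)) := by
        ring
      linarith
    have h2 := mul_le_mul_of_nonneg_left (binE_mono hp.le hq.le h1) hp.le
    refine h2.trans (le_of_eq ?_)
    simp only [binE_sub, binE_mul_left, binE_add, binE_const hpq, binE_id hpq]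
    field_simp
    linear_combination -hpq

theorem binE_pair_log_bounds (hp : 0 < p) (hq : 0 < q) (hpq : p + q = 1) (n : ℕ) :
    let T := p * binE p q n (fun k => Real.log ((k : ℝ) + 1)) +
      q * binE q p n (fun k => Real.log ((k : ℝ) + 1)) - Real.log ((n : ℝ) + 1) +
      (-(p * Real.log p) - q * Real.log q)
    0 ≤ T ∧ T ≤ 1 / ((n : ℝ) + 1) := by
  intro T
  obtain ⟨h1, h2⟩ := binE_log_bounds hp hq hpq n
  obtain ⟨h3, h4⟩ := binE_log_bounds hq hp (by linarith) n
  have e : T = p * (binE p q n (fun k => Real.log ((k : ℝ) + 1)) - Real.log ((n : ℝ) + 1) -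
      Real.log p) + q * (binE q p n (fun k => Real.log ((k : ℝ) + 1)) - Real.log ((n : ℝ) + 1) -
      Real.log q) := by
    simp only [T]
    linear_combination Real.log ((n : ℝ) + 1) * hpq
  rw [e]
  refine ⟨add_nonneg (mul_nonneg hp.le h1) (mul_nonneg hq.le h3), (add_le_add h2 h4).trans ?_⟩
  rw [← add_mul, add_comm q p, hpq, one_mul]

theorem tendsto_binE_log_sub (hp : 0 < p) (hq : 0 < q) (hpq : p + q = 1) :
    Tendsto (fun n : ℕ => binE p q n (fun k => Real.log ((k : ℝ) + 1)) -
      Real.log ((n : ℝ) + 1)) atTop (𝓝 (Real.log p)) := by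
  have h : Tendsto (fun n : ℕ => binE p q n (fun k => Real.log ((k : ℝ) + 1)) -
      Real.log ((n : ℝ) + 1) - Real.log p) atTop (𝓝 0) := by
    have h1 : Tendsto (fun n : ℕ => q / p * (1 / ((n : ℝ) + 1))) atTop (𝓝 0) := by
      simpa using tendsto_one_div_add_atTop_nhds_zero_nat.const_mul (q / p)
    refine squeeze_zero (fun n => (binE_log_bounds hp hq hpq n).1) (fun n => ?_) h1
    have := (binE_log_bounds hp hq hpq n).2
    rw [div_mul_eq_mul_div, le_div_iff₀ hp]
    linarith
  simpa using h.add_const (Real.log p)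

/-- The difference of the path length means distinguishes the two subtries when `p ≠ q`. -/
theorem tendsto_binE_sub_binE_of_recursion (hp : 0 < p) (hq : 0 < q) (hpq : p + q = 1)
    {e t : ℕ → ℝ} (ht : ∀ n, 2 ≤ n → t n = 1)
    (he : ∀ n, e n = t n + p * binE p q n e + q * binE q p n e) :
    Tendsto (fun n => binE p q n e - binE q p n e) atTop
      (𝓝 ((Real.log p - Real.log q) / (-(p * Real.log p) - q * Real.log q))) := by
  have hqp : q + p = 1 := by linarith
  set h := -(p * Real.log p) - q * Real.log q with hh
  have hh0 : 0 < h := entropy_pos hp hq hpq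
  set f : ℕ → ℝ := fun n => e n - 1 / h * Real.log ((n : ℝ) + 1) with hf
  have hTf : ∀ n, f n - p * binE p q n f - q * binE q p n f = (t n - 1) + 1 / h *
      (p * binE p q n (fun k => Real.log ((k : ℝ) + 1)) +
      q * binE q p n (fun k => Real.log ((k : ℝ) + 1)) - Real.log ((n : ℝ) + 1) + h) := fun n => by
    simp only [hf, binE_sub, binE_mul_left]
    have := he n
    have h1 : 1 / h * h = 1 := by field_simp
    linear_combination this - h1
  have hT2 : ∀ n, 2 ≤ n → 0 ≤ f n - p * binE p q n f - q * binE q p n f ∧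
      f n - p * binE p q n f - q * binE q p n f ≤ 1 / h * (1 / ((n : ℝ) + 1)) := fun n hn => by
    rw [hTf, ht n hn, sub_self, zero_add]
    obtain ⟨h1, h2⟩ := binE_pair_log_bounds hp hq hpq n
    exact ⟨mul_nonneg (by positivity) h1, mul_le_mul_of_nonneg_left h2 (by positivity)⟩
  have hlow : ∀ n, -f n - (|f 0| + |f 1|) ≤ 0 := by
    refine nonpos_of_le_binE (p := p) (q := q) (c₁ := p) (c₂ := q) (M := 1) hp.le hq.le hp.le hq.le
      (fun n hn => mul_pow_add_lt_one hp hq hpq hn.le) (fun n hn => ?_) (fun n hn => ?_)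
    · interval_cases n
      · linarith [neg_abs_le (f 0), abs_nonneg (f 1)]
      · linarith [neg_abs_le (f 1), abs_nonneg (f 0)]
    · simp only [show (fun n => -f n - (|f 0| + |f 1|)) = fun n => (-1) * f n - (|f 0| + |f 1|)
        from funext fun n => by ring, binE_sub, binE_mul_left, binE_const hpq, binE_const hqp]
      have := (hT2 n hn).1
      linear_combination this + (|f 0| + |f 1|) * hpq
  set K := 1 / (2 * p * q * h) with hK
  have hK0 : 0 < K := by positivity
  have hup : ∀ n, f n + K * (1 / ((n : ℝ) + 1)) - (|f 0| + |f 1| + K) ≤ 0 := by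
    refine nonpos_of_le_binE (p := p) (q := q) (c₁ := p) (c₂ := q) (M := 1) hp.le hq.le hp.le hq.le
      (fun n hn => mul_pow_add_lt_one hp hq hpq hn.le) (fun n hn => ?_) (fun n hn => ?_)
    · have h1 : 1 / ((n : ℝ) + 1) ≤ 1 := by
        rw [div_le_one (by positivity)]
        linarith [Nat.cast_nonneg (α := ℝ) n]
      have h2 := mul_le_mul_of_nonneg_left h1 hK0.le
      interval_cases n
      · linarith [le_abs_self (f 0), abs_nonneg (f 1)]
      · linarith [le_abs_self (f 1), abs_nonneg (f 0)]
    · simp only [binE_sub, binE_add, binE_mul_left, binE_const hpq, binE_const hqp,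
        binE_inv_succ hp hpq, binE_inv_succ hq hqp]
      have h1 := (hT2 n hn).2
      set z := 1 / ((n : ℝ) + 1) with hz
      have hz0 : 0 < z := by positivity
      have e1 : p * (K * ((1 - q ^ (n + 1)) / (p * ((n : ℝ) + 1)))) = K * z * (1 - q ^ (n + 1)) := by
        rw [hz]
        field_simp
      have e2 : q * (K * ((1 - p ^ (n + 1)) / (q * ((n : ℝ) + 1)))) = K * z * (1 - p ^ (n + 1)) := by
        rw [hz]
        field_simp
      have h2 : 1 / h * z = K * z * (2 * p * q) := by
        rw [hK]
        field_simp
      have h3 : p ^ (n + 1) ≤ p ^ 2 := pow_le_pow_of_le_one hp.le (by linarith) (by omega)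
      have h4 : q ^ (n + 1) ≤ q ^ 2 := pow_le_pow_of_le_one hq.le (by linarith) (by omega)
      have h5 : 2 * p * q ≤ 1 - p ^ (n + 1) - q ^ (n + 1) := by
        have : 2 * p * q = 1 - p ^ 2 - q ^ 2 := by
          obtain rfl : q = 1 - p := by linarith
          ring
        linarith
      have h6 := mul_le_mul_of_nonneg_left h5 (mul_pos hK0 hz0).le
      linear_combination h1 + h2 + h6 - e1 - e2 + (|f 0| + |f 1| + K) * hpq
  have hD : ∀ n, |f n| ≤ |f 0| + |f 1| + K := fun n => by
    have h1 := hlow n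
    have h2 := hup n
    have h3 : 0 < K * (1 / ((n : ℝ) + 1)) := by positivity
    exact abs_le.2 ⟨by linarith, by linarith⟩
  set G : ℕ → ℝ := fun n => f n - p * binE p q n f - q * binE q p n f with hG
  have hlim := tendsto_binE_sub_binE hp hq hpq (f := f) (D := |f 0| + |f 1| + K)
    (K := |G 0| + 2 * |G 1| + 1 / h) hD fun n => by
      have hz : 0 < 1 / ((n : ℝ) + 1) := by positivity
      have hh1 : 0 < 1 / h := by positivity
      change |G n| ≤ _
      rcases Nat.lt_or_ge n 2 with hn | hn
      · interval_cases n
        · norm_num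
          linarith [abs_nonneg (G 1), hh1, one_div h]
        · norm_num
          linarith [abs_nonneg (G 0), hh1, one_div h]
      · obtain ⟨h1, h2⟩ := hT2 n hn
        rw [abs_of_nonneg h1]
        refine h2.trans (mul_le_mul_of_nonneg_right ?_ hz.le)
        linarith [abs_nonneg (G 0), abs_nonneg (G 1)]
  have hlog := (tendsto_binE_log_sub hp hq hpq).sub (tendsto_binE_log_sub hq hp hqp)
  have := hlim.add (hlog.const_mul (1 / h))
  rw [zero_add, one_div_mul_eq_div] at this
  refine this.congr fun n => ?_
  simp only [hf, binE_sub, binE_mul_left]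
  ring

end Growth

section AlmostPeriodic

/-- The asymptotic periods of a function on the reals. -/
def asymptoticPeriods (f : ℝ → ℝ) : AddSubgroup ℝ where
  carrier := {g | Tendsto (fun t => f t - f (t - g)) atTop (𝓝 0)}
  zero_mem' := by simp
  add_mem' := by
    intro a b ha hb
    have h1 : Tendsto (fun t => f (t - a) - f (t - a - b)) atTop (𝓝 0) :=
      hb.comp (tendsto_atTop_add_const_right atTop (-a) tendsto_id)
    simpa [sub_sub] using ha.add h1
  neg_mem' := by
    intro a ha
    have h1 : Tendsto (fun t => f (t + a) - f (t + a - a)) atTop (𝓝 0) :=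
      ha.comp (tendsto_atTop_add_const_right atTop a tendsto_id)
    simpa using h1.neg

theorem mem_asymptoticPeriods {f : ℝ → ℝ} {g : ℝ} :
    g ∈ asymptoticPeriods f ↔ Tendsto (fun t => f t - f (t - g)) atTop (𝓝 0) := Iff.rfl

/-- Asymptotic uniform continuity makes bounded asymptotic periods uniform. -/
theorem exists_forall_period_le {f : ℝ → ℝ}
    (hu : ∀ ε > 0, ∃ η > 0, ∃ t₀, ∀ t ≥ t₀, ∀ t', |t' - t| ≤ η → |f t' - f t| ≤ ε)
    (W : ℝ) {ε : ℝ} (hε : 0 < ε) :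
    ∃ M, ∀ t ≥ M, ∀ g ∈ asymptoticPeriods f, |g| ≤ W → |f t - f (t - g)| ≤ ε := by
  obtain ⟨η, hη, t₀, h₀⟩ := hu (ε / 2) (by positivity)
  set s : Set ℝ := {g | g ∈ asymptoticPeriods f ∧ |g| ≤ W} with hs
  have htb : TotallyBounded s :=
    (isCompact_Icc (a := -W) (b := W)).totallyBounded.subset fun g hg => abs_le.1 hg.2
  obtain ⟨F, hF, hFin, hcov⟩ := Metric.finite_approx_of_totallyBounded htb η hη
  have h1 : ∀ᶠ t in atTop, ∀ g ∈ F, |f t - f (t - g)| ≤ ε / 2 := by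
    rw [eventually_all_finite hFin]
    intro g hg
    have h2 := (Metric.tendsto_nhds.1 (mem_asymptoticPeriods.1 (hF hg).1)) (ε / 2) (by positivity)
    filter_upwards [h2] with t ht
    rw [Real.dist_eq, sub_zero] at ht
    exact ht.le
  obtain ⟨M, hM⟩ := eventually_atTop.1 h1
  refine ⟨max M (t₀ + W), fun t ht g hg hgW => ?_⟩
  obtain ⟨g', hg', hd⟩ := Set.mem_iUnion₂.1 (hcov ⟨hg, hgW⟩)
  have h2 := hM t ((le_max_left _ _).trans ht) g' hg'
  have h3 := abs_le.1 (hF hg').2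
  have h4 := h₀ (t - g') (by linarith [(le_max_right M (t₀ + W)).trans ht]) (t - g) (by
    rw [Metric.mem_ball, Real.dist_eq] at hd
    rw [show t - g - (t - g') = -(g - g') by ring, abs_neg]
    exact hd.le)
  rw [abs_le] at *
  constructor <;> linarith

/-- A maximum principle along the lattice generated by `A` and `B`. -/
theorem le_of_subharmonic {f : ℝ → ℝ} {A B p q C K M b : ℝ} (hA : 0 < A) (hB : 0 < B)
    (hp : 0 ≤ p) (hq : 0 ≤ q) (hpq : p + q = 1)
    (hK : C + K ≤ K * (p * Real.exp (A / 2) + q * Real.exp (B / 2)))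
    {S : Set ℝ} (hSA : ∀ u ∈ S, u - A ∈ S) (hSB : ∀ u ∈ S, u - B ∈ S)
    (hrec : ∀ t ≥ M, f t ≤ p * f (t - A) + q * f (t - B) + C * Real.exp (-t / 2))
    (hbase : ∀ u ∈ S, M ≤ u → u ≤ M + max A B → f u + K * Real.exp (-u / 2) ≤ b)
    {u : ℝ} (huS : u ∈ S) (huM : M ≤ u) : f u + K * Real.exp (-u / 2) ≤ b := by
  have hm : 0 < min A B := lt_min hA hB
  have key : ∀ n : ℕ, ∀ u ∈ S, M ≤ u → u ≤ M + max A B + n * min A B →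
      f u + K * Real.exp (-u / 2) ≤ b := by
    intro n
    induction n with
    | zero =>
      intro u h1 h2 h3
      exact hbase u h1 h2 (by simpa using h3)
    | succ n ih =>
      intro u h1 h2 h3
      rcases le_or_gt u (M + max A B) with h4 | h4
      · exact hbase u h1 h2 h4
      · push_cast at h3
        have hA' := ih (u - A) (hSA u h1) (by linarith [le_max_left A B])
          (by linarith [min_le_left A B])
        have hB' := ih (u - B) (hSB u h1) (by linarith [le_max_right A B])
          (by linarith [min_le_right A B])
        have eA : Real.exp (-(u - A) / 2) = Real.exp (A / 2) * Real.exp (-u / 2) := by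
          rw [← Real.exp_add]
          ring_nf
        have eB : Real.exp (-(u - B) / 2) = Real.exp (B / 2) * Real.exp (-u / 2) := by
          rw [← Real.exp_add]
          ring_nf
        rw [eA] at hA'
        rw [eB] at hB'
        have h5 := mul_le_mul_of_nonneg_left hA' hp
        have h6 := mul_le_mul_of_nonneg_left hB' hq
        have h7 := mul_le_mul_of_nonneg_right hK (Real.exp_pos (-u / 2)).le
        have h8 := hrec u h2
        linear_combination h5 + h6 + h7 + h8 + b * hpq
  obtain ⟨n, hn⟩ := exists_nat_ge ((u - (M + max A B)) / min A B)
  rw [div_le_iff₀ hm] at hn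
  exact key n u huS huM (by linarith)

/-- Asymptotically periodic, almost harmonic functions oscillate little on far away cosets. -/
theorem exists_forall_coset_le {f : ℝ → ℝ} {A B p q C : ℝ} (hA : 0 < A) (hB : 0 < B)
    (hp : 0 < p) (hq : 0 < q) (hpq : p + q = 1)
    (hA' : A ∈ asymptoticPeriods f) (hB' : B ∈ asymptoticPeriods f)
    (hu : ∀ ε > 0, ∃ η > 0, ∃ t₀, ∀ t ≥ t₀, ∀ t', |t' - t| ≤ η → |f t' - f t| ≤ ε)
    {t₁ : ℝ} (hrec : ∀ t ≥ t₁, |f t - p * f (t - A) - q * f (t - B)| ≤ C * Real.exp (-t / 2))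
    {ε : ℝ} (hε : 0 < ε) :
    ∃ M, ∀ t ≥ M, ∀ t' ≥ M, t - t' ∈ AddSubgroup.closure {A, B} → |f t - f t'| ≤ ε := by
  set H := AddSubgroup.closure ({A, B} : Set ℝ) with hH
  have hAH : A ∈ H := AddSubgroup.subset_closure (by simp)
  have hBH : B ∈ H := AddSubgroup.subset_closure (by simp)
  have hHG : H ≤ asymptoticPeriods f := by
    rw [hH, AddSubgroup.closure_le]
    intro x hx
    rcases hx with rfl | rfl
    · exact hA'
    · exact hB'
  obtain ⟨M₁, hM₁⟩ := exists_forall_period_le hu (max A B) (ε := ε / 8) (by positivity)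
  have hC : 0 ≤ C := by
    have := (abs_nonneg _).trans (hrec t₁ le_rfl)
    exact nonneg_of_mul_nonneg_left this (Real.exp_pos _)
  set κ := p * Real.exp (A / 2) + q * Real.exp (B / 2) with hκ
  have hκ1 : 1 < κ := by
    have h1 : 1 < Real.exp (A / 2) := Real.one_lt_exp_iff.2 (by linarith)
    have h2 : 1 < Real.exp (B / 2) := Real.one_lt_exp_iff.2 (by linarith)
    nlinarith
  set K := C / (κ - 1) with hK
  have hK0 : 0 ≤ K := div_nonneg hC (by linarith)
  have hKκ : C + K ≤ K * κ := by
    have : K * (κ - 1) = C := div_mul_cancel₀ _ (by linarith)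
    linarith
  have hlim : Tendsto (fun t : ℝ => K * Real.exp (-t / 2)) atTop (𝓝 0) := by
    have h1 : Tendsto (fun t : ℝ => -t / 2) atTop atBot := by
      have := tendsto_neg_atTop_atBot (G := ℝ) |>.atBot_div_const (r := 2) (by norm_num)
      exact this
    simpa using (Real.tendsto_exp_atBot.comp h1).const_mul K
  obtain ⟨M₂, hM₂⟩ := eventually_atTop.1
    (hlim.eventually_le_const (by positivity : (0 : ℝ) < ε / 8))
  set M := max (max M₁ M₂) t₁ with hM
  have hMM₁ : M₁ ≤ M := (le_max_left _ _).trans (le_max_left _ _)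
  have hMM₂ : M₂ ≤ M := (le_max_right _ _).trans (le_max_left _ _)
  have hMt₁ : t₁ ≤ M := le_max_right _ _
  have key : ∀ s, M ≤ s → s ≤ M + max A B → ∀ u ≥ M, u - s ∈ H → |f u - f s| ≤ ε / 4 := by
    intro s hs1 hs2 u hu hus
    have hmem : ∀ D ∈ H, ∀ v ∈ {v | v - s ∈ H}, v - D ∈ {v | v - s ∈ H} := by
      intro D hD v hv
      change v - D - s ∈ H
      rw [sub_right_comm]
      exact H.sub_mem hv hD
    have hwin : ∀ v, v - s ∈ H → M ≤ v → v ≤ M + max A B → |f v - f s| ≤ ε / 8 := by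
      intro v h1 h2 h3
      have := hM₁ v (hMM₁.trans h2) (v - s) (hHG h1) (abs_le.2 ⟨by linarith, by linarith⟩)
      simpa using this
    have hexp : ∀ v, M ≤ v → K * Real.exp (-v / 2) ≤ ε / 8 := fun v hv =>
      hM₂ v (hMM₂.trans hv)
    have hpos : ∀ v, 0 ≤ K * Real.exp (-v / 2) := fun v => mul_nonneg hK0 (Real.exp_pos _).le
    have up := le_of_subharmonic (f := f) (b := f s + ε / 4) hA hB hp.le hq.le hpq hKκ
      (S := {v | v - s ∈ H}) (hmem A hAH) (hmem B hBH) (M := M)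
      (fun t ht => by linarith [(abs_le.1 (hrec t (hMt₁.trans ht))).2])
      (fun v h1 h2 h3 => by linarith [(abs_le.1 (hwin v h1 h2 h3)).2, hexp v h2]) hus hu
    have lo := le_of_subharmonic (f := fun t => -f t) (b := -f s + ε / 4) hA hB hp.le hq.le hpq hKκ
      (S := {v | v - s ∈ H}) (hmem A hAH) (hmem B hBH) (M := M)
      (fun t ht => by linarith [(abs_le.1 (hrec t (hMt₁.trans ht))).1])
      (fun v h1 h2 h3 => by linarith [(abs_le.1 (hwin v h1 h2 h3)).1, hexp v h2]) hus hu
    rw [abs_le]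
    constructor <;> linarith [hpos u]
  refine ⟨M, fun t ht t' ht' htt => ?_⟩
  set k := ⌊(t - M) / A⌋ with hk
  have hk1 : (k : ℝ) * A ≤ t - M := (le_div_iff₀ hA).1 (Int.floor_le _)
  have hk2 : t - M < (k + 1) * A := (div_lt_iff₀ hA).1 (Int.lt_floor_add_one _)
  have hkH : (k : ℝ) * A ∈ H := by
    have := H.zsmul_mem hAH k
    rwa [zsmul_eq_mul] at this
  have h1 := key (t - k * A) (by linarith) (by linarith [le_max_left A B]) t ht
    (by simpa using hkH)
  have h2 := key (t - k * A) (by linarith) (by linarith [le_max_left A B]) t' ht' (by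
    have := H.sub_mem hkH htt
    rwa [show (k : ℝ) * A - (t - t') = t' - (t - k * A) by ring] at this)
  rw [abs_le] at *
  constructor <;> linarith

/-- The periodic limit profile of an asymptotically periodic, almost harmonic function. -/
theorem exists_periodic_limit {f : ℝ → ℝ} {A B p q C : ℝ} (hA : 0 < A) (hB : 0 < B)
    (hp : 0 < p) (hq : 0 < q) (hpq : p + q = 1)
    (hA' : A ∈ asymptoticPeriods f) (hB' : B ∈ asymptoticPeriods f)
    (hu : ∀ ε > 0, ∃ η > 0, ∃ t₀, ∀ t ≥ t₀, ∀ t', |t' - t| ≤ η → |f t' - f t| ≤ ε)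
    {t₁ : ℝ} (hrec : ∀ t ≥ t₁, |f t - p * f (t - A) - q * f (t - B)| ≤ C * Real.exp (-t / 2)) :
    ∃ φ : ℝ → ℝ, (∀ t, φ (t - A) = φ t) ∧ (∀ t, φ (t - B) = φ t) ∧
      (∀ t, Tendsto (fun k : ℕ => f (t + k * A)) atTop (𝓝 (φ t))) ∧
      Tendsto (fun t => f t - φ t) atTop (𝓝 0) := by
  have hcos := fun ε hε => exists_forall_coset_le hA hB hp hq hpq hA' hB' hu hrec (ε := ε) hε
  have hAH : A ∈ AddSubgroup.closure ({A, B} : Set ℝ) := AddSubgroup.subset_closure (by simp)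
  have hshift : ∀ t, Tendsto (fun k : ℕ => t + k * A) atTop atTop := fun t =>
    tendsto_atTop_add_const_left _ _ (tendsto_natCast_atTop_atTop.atTop_mul_const hA)
  have hex : ∀ t, ∃ y, Tendsto (fun k : ℕ => f (t + k * A)) atTop (𝓝 y) := by
    intro t
    refine cauchySeq_tendsto_of_complete (Metric.cauchySeq_iff'.2 fun ε hε => ?_)
    obtain ⟨M, hM⟩ := hcos (ε / 2) (by positivity)
    obtain ⟨N, hN⟩ := eventually_atTop.1 ((hshift t).eventually_ge_atTop M)
    refine ⟨N, fun n hn => ?_⟩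
    rw [Real.dist_eq]
    refine (hM _ (hN n hn) _ (hN N le_rfl) ?_).trans_lt (by linarith)
    have := AddSubgroup.zsmul_mem _ hAH ((n : ℤ) - N)
    rw [zsmul_eq_mul] at this
    convert this using 1
    push_cast
    ring
  choose φ hφ using hex
  have hper : ∀ g ∈ asymptoticPeriods f, ∀ t, φ (t - g) = φ t := by
    intro g hg t
    have h1 := (mem_asymptoticPeriods.1 hg).comp (hshift t)
    have h2 := (hφ t).sub h1
    rw [sub_zero] at h2
    refine tendsto_nhds_unique (hφ (t - g)) (h2.congr fun k => ?_)
    simp only [Function.comp]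
    rw [sub_sub_cancel]
    congr 1
    ring
  refine ⟨φ, hper A hA', hper B hB', hφ, Metric.tendsto_nhds.2 fun ε hε => ?_⟩
  obtain ⟨M, hM⟩ := hcos (ε / 2) (by positivity)
  filter_upwards [eventually_ge_atTop M] with t ht
  rw [Real.dist_eq, sub_zero]
  have h1 : Tendsto (fun k : ℕ => |f t - f (t + k * A)|) atTop (𝓝 |f t - φ t|) :=
    ((hφ t).const_sub (f t)).abs
  refine (le_of_tendsto h1 (Eventually.of_forall fun k => ?_)).trans_lt
    (by linarith : ε / 2 < ε)
  have h2 : (0 : ℝ) ≤ k * A := by positivity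
  refine hM t ht _ (by linarith) ?_
  have := AddSubgroup.zsmul_mem _ hAH (-(k : ℤ))
  rw [zsmul_eq_mul] at this
  convert this using 1
  push_cast
  ring

end AlmostPeriodic

section Profile

variable {p q : ℝ} {d : ℕ → ℝ} {D C : ℝ}

theorem abs_sub_le_of_abs_diff_le (hC : 0 ≤ C)
    (hs : ∀ n : ℕ, |d (n + 1) - d n| ≤ C * (1 / ((n : ℝ) + 1))) {k m : ℕ} (hkm : k ≤ m) :
    |d m - d k| ≤ C * (((m : ℝ) - k) / ((k : ℝ) + 1)) := by
  induction m, hkm using Nat.le_induction with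
  | base => simp
  | succ m hkm ih =>
    have h1 := abs_sub_le (d (m + 1)) (d m) (d k)
    have h2 : 1 / ((m : ℝ) + 1) ≤ 1 / ((k : ℝ) + 1) := by
      have : (k : ℝ) ≤ m := by exact_mod_cast hkm
      gcongr
    have h3 := mul_le_mul_of_nonneg_left h2 hC
    have h4 : C * ((((m + 1 : ℕ) : ℝ) - k) / ((k : ℝ) + 1)) =
        C * (((m : ℝ) - k) / ((k : ℝ) + 1)) + C * (1 / ((k : ℝ) + 1)) := by
      push_cast
      ring
    linarith [hs m]

theorem abs_floor_sub_le (hD : ∀ n, |d n| ≤ D) (hC : 0 ≤ C)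
    (hs : ∀ n : ℕ, |d (n + 1) - d n| ≤ C * (1 / ((n : ℝ) + 1))) {x y : ℝ} (hx : 0 < x)
    (hy : 0 ≤ y) :
    |d ⌊y⌋₊ - d ⌊x⌋₊| ≤ (4 * D + 2 * C) * ((|y - x| + 1) / x) := by
  have hD0 : 0 ≤ D := (abs_nonneg _).trans (hD 0)
  rcases lt_or_ge y (x / 2) with h | h
  · have h1 : 1 / 2 ≤ (|y - x| + 1) / x := by
      rw [le_div_iff₀ hx]
      linarith [neg_abs_le (y - x)]
    have h2 := mul_le_mul_of_nonneg_left h1 (by positivity : 0 ≤ 4 * D + 2 * C)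
    have h3 := abs_sub (d ⌊y⌋₊) (d ⌊x⌋₊)
    linarith [hD ⌊y⌋₊, hD ⌊x⌋₊]
  · have hfx := Nat.floor_le hx.le
    have hfy := Nat.floor_le hy
    have hfx' := Nat.lt_floor_add_one x
    have hfy' := Nat.lt_floor_add_one y
    have key : ∀ a b c : ℝ, 0 ≤ a → a ≤ |y - x| + 1 → x / 2 ≤ b → b = c →
        C * (a / c) ≤ (4 * D + 2 * C) * ((|y - x| + 1) / x) := by
      rintro a b c ha hab hb rfl
      have hb0 : 0 < b := by linarith
      have h1 : a / b ≤ (|y - x| + 1) / (x / 2) := by gcongr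
      have h2 : (|y - x| + 1) / (x / 2) = 2 * ((|y - x| + 1) / x) := by field_simp
      have h3 := mul_le_mul_of_nonneg_left (h1.trans h2.le) hC
      have h4 : 0 ≤ D * ((|y - x| + 1) / x) := by positivity
      linarith
    rcases le_total ⌊x⌋₊ ⌊y⌋₊ with h1 | h1
    · have h2 : ((⌊x⌋₊ : ℕ) : ℝ) ≤ ⌊y⌋₊ := by exact_mod_cast h1
      exact (abs_sub_le_of_abs_diff_le hC hs h1).trans
        (key _ _ _ (by linarith) (by linarith [le_abs_self (y - x)]) (by linarith) rfl)
    · have h2 : ((⌊y⌋₊ : ℕ) : ℝ) ≤ ⌊x⌋₊ := by exact_mod_cast h1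
      rw [abs_sub_comm]
      exact (abs_sub_le_of_abs_diff_le hC hs h1).trans
        (key _ _ _ (by linarith) (by linarith [neg_abs_le (y - x)]) (by linarith) rfl)

/-- Binomial averages of a slowly varying sequence are close to its value at the mean. -/
theorem abs_binE_sub_floor_le (hp : 0 < p) (hq : 0 < q) (hpq : p + q = 1) {C : ℝ} (hC : 0 ≤ C)
    (hfl : ∀ x y : ℝ, 0 < x → 0 ≤ y → |d ⌊y⌋₊ - d ⌊x⌋₊| ≤ C * ((|y - x| + 1) / x)) {x : ℝ}
    (hx : 1 ≤ x) :
    |binE p q ⌊x⌋₊ d - d ⌊p * x⌋₊| ≤ 3 * C / p * (1 / √x) := by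
  have hx0 : 0 < x := by linarith
  have hpx : 0 < p * x := by positivity
  set n := ⌊x⌋₊ with hn
  have hnx : (n : ℝ) ≤ x := Nat.floor_le hx0.le
  have hnx' : x < n + 1 := Nat.lt_floor_add_one x
  have h1 : |binE p q n d - d ⌊p * x⌋₊| ≤ binE p q n (fun k => |d k - d ⌊p * x⌋₊|) := by
    refine le_trans (le_of_eq ?_) (abs_binE_le hp.le hq.le n _)
    rw [binE_sub, binE_const hpq]
  have h2 : binE p q n (fun k => |d k - d ⌊p * x⌋₊|) ≤
      binE p q n (fun k => C / (p * x) * (|(k : ℝ) - n * p| + 2)) := by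
    refine binE_mono hp.le hq.le fun k _ => ?_
    have h3 := hfl (p * x) k hpx (Nat.cast_nonneg k)
    rw [Nat.floor_natCast] at h3
    refine h3.trans ?_
    rw [← mul_div_assoc, div_mul_eq_mul_div]
    refine div_le_div_of_nonneg_right (mul_le_mul_of_nonneg_left ?_ hC) hpx.le
    have h4 := abs_sub_le (k : ℝ) (n * p) (p * x)
    have h5 : |(n : ℝ) * p - p * x| ≤ 1 := by
      rw [abs_le]
      constructor <;> nlinarith
    linarith
  have hsq : √x * √x = x := Real.mul_self_sqrt hx0.le
  have hsq0 : 1 ≤ √x := Real.one_le_sqrt.2 hx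
  rw [binE_mul_left, binE_add, binE_const hpq] at h2
  have h3 := (binE_abs_dev_le hp.le hq.le hpq n).trans (Real.sqrt_le_sqrt hnx)
  have h4 : C / (p * x) * (binE p q n (fun k => |(k : ℝ) - n * p|) + 2) ≤
      C / (p * x) * (3 * √x) := by
    gcongr
    linarith
  refine (h1.trans (h2.trans h4)).trans (le_of_eq ?_)
  have : √x ≠ 0 := by positivity
  field_simp
  rw [pow_two, hsq]

/-- The hypotheses satisfied by the difference sequence of the mean size. -/
structure FlatSeq (p q : ℝ) (d : ℕ → ℝ) (D C : ℝ) : Prop where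
  bound : ∀ n, |d n| ≤ D
  nonneg : 0 ≤ C
  floor_le : ∀ x y : ℝ, 0 < x → 0 ≤ y → |d ⌊y⌋₊ - d ⌊x⌋₊| ≤ C * ((|y - x| + 1) / x)
  recur : ∀ n, 2 ≤ n → d n = p * binE p q n d + q * binE q p n d
  lim : Tendsto (fun n => binE p q n d - binE q p n d) atTop (𝓝 0)

theorem FlatSeq.symm (h : FlatSeq p q d D C) : FlatSeq q p d D C :=
  ⟨h.bound, h.nonneg, h.floor_le, fun n hn => by rw [h.recur n hn, add_comm],
    by simpa using h.lim.neg⟩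

theorem FlatSeq.abs_sub_le (h : FlatSeq p q d D C) (hp : 0 < p) (hq : 0 < q) (hpq : p + q = 1)
    {x : ℝ} (hx : 2 ≤ x) :
    |d ⌊x⌋₊ - p * d ⌊p * x⌋₊ - q * d ⌊q * x⌋₊| ≤ 6 * C * (1 / √x) := by
  have h1 := abs_binE_sub_floor_le hp hq hpq h.nonneg h.floor_le (by linarith : 1 ≤ x)
  have h2 := abs_binE_sub_floor_le hq hp (by linarith) h.nonneg h.floor_le (by linarith : 1 ≤ x)
  have h3 := h.recur ⌊x⌋₊ (Nat.le_floor (by exact_mod_cast hx))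
  have e : d ⌊x⌋₊ - p * d ⌊p * x⌋₊ - q * d ⌊q * x⌋₊ =
      p * (binE p q ⌊x⌋₊ d - d ⌊p * x⌋₊) + q * (binE q p ⌊x⌋₊ d - d ⌊q * x⌋₊) := by
    rw [h3]
    ring
  rw [e]
  refine (abs_add_le _ _).trans ?_
  rw [abs_mul, abs_mul, abs_of_pos hp, abs_of_pos hq]
  have h4 := mul_le_mul_of_nonneg_left h1 hp.le
  have h5 := mul_le_mul_of_nonneg_left h2 hq.le
  have e1 : p * (3 * C / p * (1 / √x)) = 3 * C * (1 / √x) := by field_simp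
  have e2 : q * (3 * C / q * (1 / √x)) = 3 * C * (1 / √x) := by field_simp
  linarith

theorem tendsto_one_div_sqrt : Tendsto (fun x : ℝ => 1 / √x) atTop (𝓝 0) := by
  simp only [one_div]
  exact tendsto_inv_atTop_zero.comp Real.tendsto_sqrt_atTop

theorem FlatSeq.tendsto_sub (h : FlatSeq p q d D C) (hp : 0 < p) (hq : 0 < q)
    (hpq : p + q = 1) :
    Tendsto (fun x : ℝ => d ⌊x⌋₊ - d ⌊p * x⌋₊) atTop (𝓝 0) := by
  have h1 : Tendsto (fun x : ℝ => -q * (binE p q ⌊x⌋₊ d - binE q p ⌊x⌋₊ d)) atTop (𝓝 0) := by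
    simpa using (h.lim.comp (tendsto_nat_floor_atTop (α := ℝ))).const_mul (-q)
  have h2 : Tendsto (fun x : ℝ => binE p q ⌊x⌋₊ d - d ⌊p * x⌋₊) atTop (𝓝 0) := by
    have h3 : Tendsto (fun x : ℝ => 3 * C / p * (1 / √x)) atTop (𝓝 0) := by
      simpa using tendsto_one_div_sqrt.const_mul (3 * C / p)
    refine squeeze_zero_norm' ?_ h3
    filter_upwards [eventually_ge_atTop 1] with x hx
    exact abs_binE_sub_floor_le hp hq hpq h.nonneg h.floor_le hx
  have h4 := h1.add h2
  rw [add_zero] at h4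
  refine h4.congr' ?_
  filter_upwards [eventually_ge_atTop 2] with x hx
  have h3 := h.recur ⌊x⌋₊ (Nat.le_floor (by exact_mod_cast hx))
  rw [h3]
  linear_combination (-binE p q ⌊x⌋₊ d) * hpq

theorem exp_sub_neg_log (hp : 0 < p) (t : ℝ) : Real.exp (t - -Real.log p) = p * Real.exp t := by
  rw [sub_neg_eq_add, Real.exp_add, Real.exp_log hp, mul_comm]

theorem FlatSeq.mem_periods (h : FlatSeq p q d D C) (hp : 0 < p) (hq : 0 < q)
    (hpq : p + q = 1) :
    -Real.log p ∈ asymptoticPeriods (fun t => d ⌊Real.exp t⌋₊) := by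
  rw [mem_asymptoticPeriods]
  simp only [exp_sub_neg_log hp]
  exact (h.tendsto_sub hp hq hpq).comp Real.tendsto_exp_atTop

theorem FlatSeq.exists_profile (h : FlatSeq p q d D C) (hp : 0 < p) (hq : 0 < q)
    (hpq : p + q = 1) (hDC : 2 * D ≤ C) :
    ∃ G : ℝ → ℝ, (∀ x, 0 < x → G (p * x) = G x) ∧ (∀ x, 0 < x → G (q * x) = G x) ∧
      (∀ x, |G x| ≤ D) ∧
      (∀ x y, 0 < x → 0 ≤ y → |G y - G x| ≤ C * ((|y - x| + 1) / x)) ∧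
      Tendsto (fun n : ℕ => d n - G n) atTop (𝓝 0) := by
  have hA : 0 < -Real.log p := by linarith [Real.log_neg hp (by linarith)]
  have hB : 0 < -Real.log q := by linarith [Real.log_neg hq (by linarith)]
  obtain ⟨φ, hφA, hφB, hφ, hφlim⟩ := exists_periodic_limit (f := fun t => d ⌊Real.exp t⌋₊)
    (A := -Real.log p) (B := -Real.log q) (C := 6 * C) (t₁ := 1) hA hB hp hq hpq
    (h.mem_periods hp hq hpq) (h.symm.mem_periods hq hp (by linarith))
    (fun ε hε => by
      have hC1 : 0 < 3 * C + 1 := by linarith [h.nonneg]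
      refine ⟨min 1 (ε / (3 * C + 1)), by positivity, -Real.log (ε / (3 * C + 1)),
        fun t ht t' htt => ?_⟩
      refine (h.floor_le _ _ (Real.exp_pos t) (Real.exp_pos t').le).trans ?_
      have h1 := Real.abs_exp_sub_one_le (htt.trans (min_le_left _ _))
      have h2 := htt.trans (min_le_right _ _)
      have h3 : (|Real.exp t' - Real.exp t| + 1) / Real.exp t =
          |Real.exp (t' - t) - 1| + Real.exp (-t) := by
        rw [Real.exp_sub, Real.exp_neg, add_div, ← abs_of_pos (Real.exp_pos t), ← abs_div,
          abs_of_pos (Real.exp_pos t), sub_div, div_self (Real.exp_pos t).ne', one_div]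
      have h4 : Real.exp (-t) ≤ ε / (3 * C + 1) := by
        rw [← Real.exp_log (by positivity : 0 < ε / (3 * C + 1))]
        exact Real.exp_le_exp.2 (by linarith)
      rw [h3]
      have h5 := mul_le_mul_of_nonneg_left
        (show |Real.exp (t' - t) - 1| + Real.exp (-t) ≤ 3 * (ε / (3 * C + 1)) by linarith) h.nonneg
      refine h5.trans ?_
      have h6 : ε / (3 * C + 1) * (3 * C + 1) = ε := div_mul_cancel₀ _ hC1.ne'
      have h7 : 0 < ε / (3 * C + 1) := by positivity
      linarith)
    (fun t ht => by
      simp only [exp_sub_neg_log hp, exp_sub_neg_log hq]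
      have h1 : (2 : ℝ) ≤ Real.exp t := by linarith [Real.add_one_le_exp t]
      have h2 := h.abs_sub_le hp hq hpq h1
      have h3 : 1 / √(Real.exp t) = Real.exp (-t / 2) := by
        rw [← Real.exp_half, one_div, ← Real.exp_neg, neg_div]
      rwa [h3] at h2)
  have hlog : ∀ {a x : ℝ}, 0 < a → 0 < x → Real.log (a * x) = Real.log x - -Real.log a :=
    fun ha hx => by rw [Real.log_mul ha.ne' hx.ne']; ring
  have hbound : ∀ t, |φ t| ≤ D := fun t =>
    le_of_tendsto (hφ t).abs (Eventually.of_forall fun k => h.bound _)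
  refine ⟨fun x => φ (Real.log x), fun x hx => by simp only [hlog hp hx, hφA],
    fun x hx => by simp only [hlog hq hx, hφB], fun x => hbound _, fun x y hx hy => ?_, ?_⟩
  · rcases hy.eq_or_lt with rfl | hy
    · have h1 : 1 ≤ (|0 - x| + 1) / x := by
        rw [le_div_iff₀ hx, zero_sub, abs_neg, abs_of_pos hx]
        linarith
      have h2 := mul_le_mul_of_nonneg_left h1 h.nonneg
      have h3 := abs_sub (φ (Real.log 0)) (φ (Real.log x))
      linarith [hbound (Real.log 0), hbound (Real.log x)]
    · have h1 := ((hφ (Real.log y)).sub (hφ (Real.log x))).abs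
      refine le_of_tendsto h1 (Eventually.of_forall fun k => ?_)
      simp only [Real.exp_add, Real.exp_log hx, Real.exp_log hy]
      set E := Real.exp (k * -Real.log p) with hE
      have hE1 : 1 ≤ E := Real.one_le_exp (by positivity)
      have hE0 : 0 < E := by linarith
      refine (h.floor_le (x * E) (y * E) (by positivity) (by positivity)).trans ?_
      refine mul_le_mul_of_nonneg_left ?_ h.nonneg
      rw [← sub_mul, abs_mul, abs_of_pos hE0, div_le_div_iff₀ (by positivity) hx]
      nlinarith [mul_le_mul_of_nonneg_right hE1 hx.le]
  · have h1 := hφlim.comp (Real.tendsto_log_atTop.comp (tendsto_natCast_atTop_atTop (R := ℝ)))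
    refine h1.congr' ?_
    filter_upwards [eventually_gt_atTop 0] with n hn
    have : (0 : ℝ) < n := by exact_mod_cast hn
    simp [Real.exp_log this]

end Profile

section Majorant

variable {p q : ℝ} {d : ℕ → ℝ} {D C : ℝ}

theorem le_binE_of_abs_sub_le (hp : 0 < p) (hq : 0 < q) (hpq : p + q = 1) {φ : ℕ → ℝ} {n : ℕ}
    {a c : ℝ} (hc : 0 ≤ c) (h : ∀ k : ℕ, |φ k - a| ≤ c * (|(k : ℝ) - n * p| + 1)) :
    a - c * (√n + 1) ≤ binE p q n φ := by
  have h1 : binE p q n (fun k => a - c * (|(k : ℝ) - n * p| + 1)) ≤ binE p q n φ :=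
    binE_mono hp.le hq.le fun k _ => by linarith [(abs_le.1 (h k)).1]
  rw [binE_sub, binE_mul_left, binE_add, binE_const hpq, binE_const hpq] at h1
  have h2 := mul_le_mul_of_nonneg_left (binE_abs_dev_le hp.le hq.le hpq n) hc
  linarith

theorem binE_sqrt_ge (hp : 0 < p) (hq : 0 < q) (hpq : p + q = 1) {n : ℕ} (hn : 0 < n) :
    √p * √n - 1 / √p ≤ binE p q n (fun k => √k) := by
  have hn' : (0 : ℝ) < n := by exact_mod_cast hn
  have hx : 0 < (n : ℝ) * p := by positivity
  have hs : 0 < √((n : ℝ) * p) := Real.sqrt_pos.2 hx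
  have h1 : binE p q n (fun k => √(n * p) - 1 / √(n * p) * |(k : ℝ) - n * p|) ≤
      binE p q n (fun k => √k) := by
    refine binE_mono hp.le hq.le fun k _ => ?_
    rw [one_div_mul_eq_div, sub_le_iff_le_add, ← sub_le_iff_le_add', le_div_iff₀ hs]
    have h2 := Real.mul_self_sqrt (Nat.cast_nonneg (α := ℝ) k)
    have h3 := Real.mul_self_sqrt hx.le
    have h4 := Real.sqrt_nonneg (k : ℝ)
    rcases le_total (√(n * p)) √k with h5 | h5
    · nlinarith [abs_nonneg ((k : ℝ) - n * p)]
    · nlinarith [neg_abs_le ((k : ℝ) - n * p)]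
  rw [binE_sub, binE_mul_left, binE_const hpq] at h1
  have h2 := mul_le_mul_of_nonneg_left (binE_abs_dev_le hp.le hq.le hpq n)
    (by positivity : 0 ≤ 1 / √((n : ℝ) * p))
  have h3 : 1 / √((n : ℝ) * p) * √n = 1 / √p := by
    rw [Real.sqrt_mul hn'.le]
    field_simp
  rw [Real.sqrt_mul hn'.le] at h1 h2 h3
  linarith

theorem abs_mul_sq_sub_le {x y u v D C : ℝ} (hx : 0 < x) (hD : 0 ≤ D) (hu : |u| ≤ 2 * D)
    (hv : |v| ≤ 2 * D) (h : |v - u| ≤ 2 * C * ((|y - x| + 1) / x)) :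
    |y * v ^ 2 - x * u ^ 2| ≤ (4 * D ^ 2 + 8 * D * C) * (|y - x| + 1) := by
  have e : y * v ^ 2 - x * u ^ 2 = (y - x) * v ^ 2 + x * ((v - u) * (v + u)) := by ring
  rw [e]
  refine (abs_add_le _ _).trans ?_
  rw [abs_mul, abs_mul, abs_mul, abs_of_pos hx, abs_of_nonneg (sq_nonneg v)]
  have h1 : v ^ 2 ≤ 4 * D ^ 2 := by
    rw [← sq_abs]
    nlinarith [abs_nonneg v]
  have h2 : |v + u| ≤ 4 * D := (abs_add_le _ _).trans (by linarith)
  have h3 : x * |v - u| ≤ 2 * C * (|y - x| + 1) := by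
    have := mul_le_mul_of_nonneg_left h hx.le
    refine this.trans (le_of_eq ?_)
    field_simp
  have h4 : x * (|v - u| * |v + u|) ≤ 2 * C * (|y - x| + 1) * (4 * D) := by
    rw [← mul_assoc]
    refine mul_le_mul h3 h2 (abs_nonneg _) (le_trans (by positivity) h3)
  have h5 := mul_le_mul_of_nonneg_left h1 (abs_nonneg (y - x))
  nlinarith [sq_nonneg D]

theorem sq_energy_le {p q a b c D η : ℝ} (hp : 0 ≤ p) (hq : 0 ≤ q) (hpq : p + q = 1)
    (ha : |a| ≤ 2 * D) (hb : |b| ≤ 2 * D) (hc : |c| ≤ 2 * D) (h : |c - p * a - q * b| ≤ η) :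
    c ^ 2 + p * q * (a - b) ^ 2 - 4 * D * η ≤ p * a ^ 2 + q * b ^ 2 := by
  have e : p * a ^ 2 + q * b ^ 2 = (p * a + q * b) ^ 2 + p * q * (a - b) ^ 2 := by
    obtain rfl : q = 1 - p := by linarith
    ring
  have h1 : |p * a + q * b| ≤ 2 * D := by
    refine (abs_add_le _ _).trans ?_
    rw [abs_mul, abs_mul, abs_of_nonneg hp, abs_of_nonneg hq]
    linear_combination mul_le_mul_of_nonneg_left ha hp + mul_le_mul_of_nonneg_left hb hq +
      2 * D * hpq
  have h2 : |(c - p * a - q * b) * (c + (p * a + q * b))| ≤ η * (4 * D) := by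
    rw [abs_mul]
    refine mul_le_mul h ((abs_add_le _ _).trans (by linarith)) (abs_nonneg _)
      ((abs_nonneg _).trans h)
  have h3 := le_abs_self ((c - p * a - q * b) * (c + (p * a + q * b)))
  rw [e]
  nlinarith

/-- A potential whose defect in the trie recursion dominates the squared gap. -/
theorem FlatSeq.exists_potential (h : FlatSeq p q d D C) (hp : 0 < p) (hq : 0 < q)
    (hpq : p + q = 1) (hDC : 2 * D ≤ C) :
    ∃ (r : ℕ → ℝ) (K : ℝ), 0 ≤ K ∧ (∀ n, |r n| ≤ 2 * D) ∧ Tendsto r atTop (𝓝 0) ∧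
      ∀ n : ℕ, 2 ≤ n → n * r n ^ 2 + p * q * (n * (d ⌊p * n⌋₊ - d ⌊q * n⌋₊) ^ 2) - K * √n ≤
        binE p q n (fun k => k * r k ^ 2) + binE q p n (fun k => k * r k ^ 2) := by
  have hqp : q + p = 1 := by linarith
  obtain ⟨G, hGp, hGq, hGD, hGC, hGlim⟩ := h.exists_profile hp hq hpq hDC
  have hD : 0 ≤ D := (abs_nonneg _).trans (h.bound 0)
  have hC := h.nonneg
  set R : ℝ → ℝ := fun x => d ⌊x⌋₊ - G x with hR
  have hRD : ∀ x, |R x| ≤ 2 * D := fun x => (abs_sub _ _).trans (by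
    linarith [h.bound ⌊x⌋₊, hGD x])
  have hRC : ∀ x y, 0 < x → 0 ≤ y → |R y - R x| ≤ 2 * C * ((|y - x| + 1) / x) :=
    fun x y hx hy => by
      rw [show R y - R x = (d ⌊y⌋₊ - d ⌊x⌋₊) - (G y - G x) by simp only [hR]; ring]
      refine (abs_sub _ _).trans ?_
      linarith [h.floor_le x y hx hy, hGC x y hx hy]
  set c := 4 * D ^ 2 + 8 * D * C with hc
  have hc0 : 0 ≤ c := by positivity
  refine ⟨fun n => R n, 4 * c + 24 * D * C, by positivity, fun n => hRD n, ?_, fun n hn => ?_⟩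
  · simpa [hR] using hGlim
  have hn' : (2 : ℝ) ≤ n := by exact_mod_cast hn
  have hn0 : (0 : ℝ) < n := by linarith
  have hlow : ∀ {p q : ℝ}, 0 < p → 0 < q → p + q = 1 →
      p * n * R (p * n) ^ 2 - c * (√n + 1) ≤ binE p q n (fun k => k * R k ^ 2) := by
    intro p q hp hq hpq
    refine le_binE_of_abs_sub_le hp hq hpq hc0 fun k => ?_
    have hpn : 0 < p * n := by positivity
    rw [mul_comm (n : ℝ) p]
    exact abs_mul_sq_sub_le hpn hD (hRD _) (hRD _) (hRC _ _ hpn (Nat.cast_nonneg k))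
  have h1 := hlow hp hq hpq
  have h2 := hlow hq hp hqp
  have h3 := h.abs_sub_le hp hq hpq hn'
  have hpR : R (p * n) = d ⌊p * n⌋₊ - G n := by simp only [hR, hGp _ hn0]
  have hqR : R (q * n) = d ⌊q * n⌋₊ - G n := by simp only [hR, hGq _ hn0]
  have h4 := sq_energy_le hp.le hq.le hpq (hRD (p * n)) (hRD (q * n)) (hRD n)
    (η := 6 * C * (1 / √n)) (by
      refine le_trans (le_of_eq ?_) h3
      congr 1
      rw [hpR, hqR]
      simp only [hR]
      linear_combination G n * hpq)
  have h5 := mul_le_mul_of_nonneg_left h4 hn0.le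
  have hs : (n : ℝ) * (1 / √n) = √n := by
    rw [mul_one_div, Real.div_sqrt]
  have hs1 : 1 ≤ √(n : ℝ) := Real.one_le_sqrt.2 (by linarith)
  have h6 : R (p * n) - R (q * n) = d ⌊p * n⌋₊ - d ⌊q * n⌋₊ := by
    rw [hpR, hqR]
    ring
  rw [h6] at h5
  have h7 := mul_le_mul_of_nonneg_left hs1 hc0
  have h8 : (n : ℝ) * (4 * D * (6 * C * (1 / √n))) = 24 * D * C * √n := by
    linear_combination 24 * D * C * hs
  linarith

/-- Supersolutions of sublinear size for tolls controlled by the squared gap. -/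
theorem FlatSeq.exists_majorant (h : FlatSeq p q d D C) (hp : 0 < p) (hq : 0 < q)
    (hpq : p + q = 1) (hDC : 2 * D ≤ C) {α : ℕ → ℝ} {c : ℝ} (hc : 0 ≤ c)
    (hα : ∀ n : ℕ, 2 ≤ n → α n ≤ c * (n * (d ⌊p * n⌋₊ - d ⌊q * n⌋₊) ^ 2 + 1)) {ε : ℝ}
    (hε : 0 < ε) :
    ∃ (M : ℕ) (F : ℕ → ℝ), 2 ≤ M ∧ (∀ n, 0 ≤ F n) ∧ (∀ n : ℕ, M ≤ n → F n ≤ ε * n) ∧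
      ∀ n, M ≤ n → binE p q n F + binE q p n F + α n ≤ F n := by
  have hqp : q + p = 1 := by linarith
  obtain ⟨r, K, hK0, hrD, hr, hpot⟩ := h.exists_potential hp hq hpq hDC
  have hsp : 0 < √p := Real.sqrt_pos.2 hp
  have hsq : 0 < √q := Real.sqrt_pos.2 hq
  have hκ : 1 < √p + √q := by
    have h1 := Real.mul_self_sqrt hp.le
    have h2 := Real.mul_self_sqrt hq.le
    have h3 : √p < 1 := by rw [Real.sqrt_lt' one_pos]; linarith
    have h4 : √q < 1 := by rw [Real.sqrt_lt' one_pos]; linarith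
    nlinarith
  set κ := √p + √q with hκdef
  set a := c / (p * q) with ha
  have ha0 : 0 ≤ a := by positivity
  set b := (a * K + c + 1) * (2 / (κ - 1)) with hb
  have hb0 : 0 ≤ b := mul_nonneg (by positivity) (div_nonneg (by norm_num) (by linarith))
  have hsqrt_lim : Tendsto (fun n : ℕ => √(n : ℝ)) atTop atTop :=
    Real.tendsto_sqrt_atTop.comp tendsto_natCast_atTop_atTop
  have hev1 : ∀ᶠ n : ℕ in atTop, a * (n * r n ^ 2) + b * √n ≤ ε * n := by
    have h1 : Tendsto (fun n : ℕ => a * r n ^ 2 + b * (1 / √(n : ℝ))) atTop (𝓝 0) := by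
      have h2 := (hr.pow 2).const_mul a
      have h3 := (tendsto_one_div_sqrt.comp (tendsto_natCast_atTop_atTop (R := ℝ))).const_mul b
      simpa using h2.add h3
    filter_upwards [h1.eventually_le_const hε, eventually_gt_atTop 0] with n hn hn0
    have hn0' : (0 : ℝ) < n := by exact_mod_cast hn0
    have h2 := mul_le_mul_of_nonneg_right hn hn0'.le
    have h3 : 1 / √(n : ℝ) * n = √n := by rw [one_div_mul_eq_div, Real.div_sqrt]
    have h4 : b * (1 / √(n : ℝ)) * n = b * √n := by rw [mul_assoc, h3]
    linarith
  obtain ⟨M₁, hM₁⟩ := eventually_atTop.1 hev1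
  set c₁ := (a * (2 * D) ^ 2 + b) * M₁ with hc₁
  have hc₁0 : 0 ≤ c₁ := by positivity
  have hev2 : ∀ᶠ n : ℕ in atTop, 2 * c₁ ≤ √(n : ℝ) := hsqrt_lim.eventually_ge_atTop _
  have hev3 : ∀ᶠ n : ℕ in atTop, (1 / √p + 1 / √q) * (2 / (κ - 1)) ≤ √(n : ℝ) :=
    hsqrt_lim.eventually_ge_atTop _
  obtain ⟨M₂, hM₂⟩ := eventually_atTop.1 (hev2.and hev3)
  set F : ℕ → ℝ := fun n => ε * n - a * (n * r n ^ 2) - b * √n + (if n < M₁ then c₁ else 0)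
    with hF
  refine ⟨max (max M₁ M₂) 2, F, le_max_right _ _, fun n => ?_, fun n hn => ?_, fun n hn => ?_⟩
  · simp only [hF]
    split_ifs with hlt
    · have h1 : r n ^ 2 ≤ (2 * D) ^ 2 := by
        rw [← sq_abs]
        exact pow_le_pow_left₀ (abs_nonneg _) (hrD n) 2
      have hnM : (n : ℝ) ≤ M₁ := by exact_mod_cast hlt.le
      have h2 : √(n : ℝ) ≤ n := by
        rcases Nat.eq_zero_or_pos n with rfl | hn
        · simp
        · have h3 : (1 : ℝ) ≤ n := by exact_mod_cast hn
          have := Real.mul_self_sqrt (Nat.cast_nonneg (α := ℝ) n)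
          nlinarith [Real.one_le_sqrt.2 h3]
      have h3 : a * ((n : ℝ) * r n ^ 2) ≤ a * (2 * D) ^ 2 * M₁ := by
        rw [mul_assoc, mul_comm ((2 * D) ^ 2)]
        gcongr
      have h4 : b * √(n : ℝ) ≤ b * M₁ := by
        gcongr
        exact h2.trans hnM
      have h5 : 0 ≤ ε * (n : ℝ) := by positivity
      linarith
    · linarith [hM₁ n (by omega)]
  · simp only [hF]
    rw [if_neg (by have := (le_max_left M₁ M₂).trans (le_max_left _ 2); omega)]
    have : 0 ≤ a * ((n : ℝ) * r n ^ 2) := by positivity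
    have : 0 ≤ b * √(n : ℝ) := by positivity
    linarith
  · have hnM₁ : M₁ ≤ n := ((le_max_left _ _).trans (le_max_left _ _)).trans hn
    have hnM₂ : M₂ ≤ n := ((le_max_right _ _).trans (le_max_left _ _)).trans hn
    have hn2 : 2 ≤ n := (le_max_right _ _).trans hn
    obtain ⟨h2, h3⟩ := hM₂ n hnM₂
    have h4 := mul_le_mul_of_nonneg_left (hpot n hn2) ha0
    have h5 := hα n hn2
    have hind : ∀ {p q : ℝ}, 0 < p → 0 < q → p + q = 1 →
        binE p q n (fun k => if k < M₁ then c₁ else 0) ≤ c₁ := fun hp hq hpq => by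
      refine (binE_mono hp.le hq.le fun k _ => ?_).trans (le_of_eq (binE_const hpq n c₁))
      split_ifs
      · exact le_rfl
      · exact hc₁0
    have h6 := hind hp hq hpq
    have h7 := hind hq hp hqp
    have h8 := add_le_add (binE_sqrt_ge hp hq hpq (by omega : 0 < n))
      (binE_sqrt_ge hq hp hqp (by omega : 0 < n))
    have hs1 : 1 ≤ √(n : ℝ) := Real.one_le_sqrt.2 (by exact_mod_cast (by omega : 1 ≤ n))
    have h9 : (a * K + c + 1) * √n ≤
        b * (binE p q n (fun k => √k) + binE q p n (fun k => √k) - √n) := by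
      have e1 : b * ((κ - 1) / 2 * √n) = (a * K + c + 1) * √n := by
        have : κ - 1 ≠ 0 := by linarith
        rw [hb]
        field_simp
      rw [← e1]
      refine mul_le_mul_of_nonneg_left ?_ hb0
      have h10 := mul_le_mul_of_nonneg_left h3 (by linarith : 0 ≤ (κ - 1) / 2)
      have e2 : (κ - 1) / 2 * ((1 / √p + 1 / √q) * (2 / (κ - 1))) = 1 / √p + 1 / √q := by
        have : κ - 1 ≠ 0 := by linarith
        field_simp
      rw [e2] at h10
      have e3 : √p * √(n : ℝ) + √q * √n = κ * √n := by rw [hκdef]; ring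
      linarith
    have e4 : a * (p * q * ((n : ℝ) * (d ⌊p * n⌋₊ - d ⌊q * n⌋₊) ^ 2)) =
        c * (n * (d ⌊p * n⌋₊ - d ⌊q * n⌋₊) ^ 2) := by
      rw [ha]
      field_simp
    have h11 := mul_le_mul_of_nonneg_left hs1 hc
    simp only [hF, binE_add, binE_sub, binE_mul_left, binE_id hpq, binE_id hqp]
    rw [if_neg (by omega)]
    linear_combination h4 + h5 + h6 + h7 + h9 + h11 + h2 - e4 + ε * n * hpq

end Majorant

section Recursion

/-- The covariance of two real functions under a measure. -/
noncomputable def covOf {α : Type*} [MeasurableSpace α] (ν : Measure α) (u v : α → ℝ) : ℝ :=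
  ∫ x, (u x - ∫ y, u y ∂ν) * (v x - ∫ y, v y ∂ν) ∂ν

theorem covOf_eq {α : Type*} [MeasurableSpace α] {ν : Measure α} [IsProbabilityMeasure ν]
    {u v : α → ℝ} (hu : Integrable u ν) (hv : Integrable v ν)
    (huv : Integrable (fun x => u x * v x) ν) :
    covOf ν u v = ∫ x, u x * v x ∂ν - (∫ x, u x ∂ν) * ∫ x, v x ∂ν := by
  rw [covOf]
  set a := ∫ x, u x ∂ν with ha
  set b := ∫ x, v x ∂ν with hb
  rw [show (fun x => (u x - a) * (v x - b)) =
    fun x => ((u x * v x - b * u x) - a * v x) + a * b from funext fun x => by ring]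
  have h1 : Integrable (fun x => b * u x) ν := hu.const_mul b
  have h2 : Integrable (fun x => a * v x) ν := hv.const_mul a
  have h3 : Integrable (fun x => u x * v x - b * u x) ν := huv.sub h1
  have h4 : Integrable (fun x => u x * v x - b * u x - a * v x) ν := h3.sub h2
  rw [integral_add h4 (integrable_const _), integral_sub h3 h2, integral_sub huv h1,
    integral_const_mul, integral_const_mul, ← ha, ← hb]
  simp
  ring

theorem integral_prod_add {α : Type*} [MeasurableSpace α] {ν₁ ν₂ : Measure α}
    [IsProbabilityMeasure ν₁] [IsProbabilityMeasure ν₂] {u : α → ℝ}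
    (hu₁ : Integrable u ν₁) (hu₂ : Integrable u ν₂) (s : ℝ) :
    ∫ z, (u z.1 + u z.2 + s) ∂(ν₁.prod ν₂) = ∫ x, u x ∂ν₁ + ∫ x, u x ∂ν₂ + s := by
  have h1 : Integrable (fun z : α × α => u z.1) (ν₁.prod ν₂) := hu₁.comp_fst ν₂
  have h2 : Integrable (fun z : α × α => u z.2) (ν₁.prod ν₂) := hu₂.comp_snd ν₁
  have h3 : Integrable (fun z : α × α => u z.1 + u z.2) (ν₁.prod ν₂) := h1.add h2
  rw [integral_add h3 (integrable_const _), integral_add h1 h2, integral_fun_fst,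
    integral_fun_snd]
  simp

theorem integral_prod_add_mul_add {α : Type*} [MeasurableSpace α] {ν₁ ν₂ : Measure α}
    [IsProbabilityMeasure ν₁] [IsProbabilityMeasure ν₂] {u v : α → ℝ}
    (hu₁ : Integrable u ν₁) (hv₁ : Integrable v ν₁) (huv₁ : Integrable (fun x => u x * v x) ν₁)
    (hu₂ : Integrable u ν₂) (hv₂ : Integrable v ν₂) (huv₂ : Integrable (fun x => u x * v x) ν₂)
    (s t : ℝ) :
    ∫ z, (u z.1 + u z.2 + s) * (v z.1 + v z.2 + t) ∂(ν₁.prod ν₂) =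
      covOf ν₁ u v + covOf ν₂ u v +
        (∫ x, u x ∂ν₁ + ∫ x, u x ∂ν₂ + s) * (∫ x, v x ∂ν₁ + ∫ x, v x ∂ν₂ + t) := by
  rw [covOf_eq hu₁ hv₁ huv₁, covOf_eq hu₂ hv₂ huv₂]
  rw [show (fun z : α × α => (u z.1 + u z.2 + s) * (v z.1 + v z.2 + t)) =
    fun z => ((u z.1 * v z.1 + t * u z.1 + s * v z.1) + (u z.2 * v z.2 + t * u z.2 + s * v z.2)) +
      (u z.1 * v z.2 + v z.1 * u z.2 + s * t) from funext fun z => by ring]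
  have a1 : Integrable (fun x => u x * v x + t * u x) ν₁ := huv₁.add (hu₁.const_mul t)
  have a2 : Integrable (fun x => u x * v x + t * u x + s * v x) ν₁ := a1.add (hv₁.const_mul s)
  have b1 : Integrable (fun x => u x * v x + t * u x) ν₂ := huv₂.add (hu₂.const_mul t)
  have b2 : Integrable (fun x => u x * v x + t * u x + s * v x) ν₂ := b1.add (hv₂.const_mul s)
  have h1 := a2.comp_fst ν₂
  have h2 := b2.comp_snd ν₁
  have h12 : Integrable (fun z : α × α => (u z.1 * v z.1 + t * u z.1 + s * v z.1) +
      (u z.2 * v z.2 + t * u z.2 + s * v z.2)) (ν₁.prod ν₂) := h1.add h2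
  have c1 := hu₁.mul_prod hv₂
  have c2 := hv₁.mul_prod hu₂
  have c3 : Integrable (fun z : α × α => u z.1 * v z.2 + v z.1 * u z.2) (ν₁.prod ν₂) := c1.add c2
  have h3 : Integrable (fun z : α × α => u z.1 * v z.2 + v z.1 * u z.2 + s * t) (ν₁.prod ν₂) :=
    c3.add (integrable_const _)
  have e1 := integral_fun_fst (ν := ν₂) (μ := ν₁) (fun x => u x * v x + t * u x + s * v x)
  have e2 := integral_fun_snd (ν := ν₂) (μ := ν₁) (fun x => u x * v x + t * u x + s * v x)
  rw [integral_add h12 h3, integral_add h1 h2, e1, e2,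
    integral_add c3 (integrable_const _), integral_add c1 c2, integral_prod_mul, integral_prod_mul,
    integral_add a1 (hv₁.const_mul s), integral_add huv₁ (hu₁.const_mul t),
    integral_add b1 (hv₂.const_mul s), integral_add huv₂ (hu₂.const_mul t)]
  simp only [integral_const_mul, probReal_univ, integral_const, smul_eq_mul]
  ring

theorem measurable_trieStep (n : ℕ) : Measurable (trieStep n) := by
  refine measurable_from_prod_countable_right fun k => ?_
  have h1 : Measurable (fun y : (ℕ → ℕ × ℕ) × (ℕ → ℕ × ℕ) => (y.1 k, y.2 (n - k))) := by fun_prop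
  exact (measurable_of_countable (fun x : (ℕ × ℕ) × (ℕ × ℕ) =>
    (x.1.1 + x.2.1 + 1, x.1.2 + x.2.2 + n))).comp h1

theorem integral_binomialMeasure {p q : ℝ} (hp : 0 ≤ p) (hq : 0 ≤ q) (hpq : p + q = 1) (n : ℕ)
    (f : ℕ → ℝ) : ∫ k, f k ∂(binomialMeasure n p) = binE p q n f := by
  obtain rfl : q = 1 - p := by linarith
  rw [binomialMeasure, integral_finsetSum_measure, binE_eq_sum]
  · refine Finset.sum_congr rfl fun k _ => ?_
    rw [integral_smul_measure, integral_dirac, ENNReal.toReal_ofReal (by positivity), smul_eq_mul]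
  · intro k _
    exact (integrable_dirac (by simp)).smul_measure ENNReal.ofReal_ne_top

variable {p q : ℝ} {μ : ℕ → Measure (ℕ × ℕ)}

theorem IsTriePairFamily.integral_eq (hμ : IsTriePairFamily p μ) (hp : 0 ≤ p) (hq : 0 ≤ q)
    (hpq : p + q = 1) {n : ℕ} (hn : 2 ≤ n) {F : ℕ × ℕ → ℝ} (hF : Integrable F (μ n)) :
    ∫ x, F x ∂μ n = binE p q n (fun k => ∫ z, F (z.1.1 + z.2.1 + 1, z.1.2 + z.2.2 + n)
      ∂((μ k).prod (μ (n - k)))) := by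
  obtain ⟨P, hP, h1, h2, h3, h4, h5⟩ := hμ.recur n hn
  have hF' : Integrable (F ∘ trieStep n) P := by
    rw [h5] at hF
    exact (integrable_map_measure (measurable_of_countable F).aestronglyMeasurable
      (measurable_trieStep n).aemeasurable).1 hF
  rw [h5, integral_map (measurable_trieStep n).aemeasurable
    (measurable_of_countable F).aestronglyMeasurable]
  set P₁ := P.map (fun ω => ω.2.1) with hP₁
  set P₂ := P.map (fun ω => ω.2.2) with hP₂
  have : IsProbabilityMeasure P₁ := Measure.isProbabilityMeasure_map (by fun_prop)
  have : IsProbabilityMeasure P₂ := Measure.isProbabilityMeasure_map (by fun_prop)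
  have : IsProbabilityMeasure (P.map Prod.fst) := Measure.isProbabilityMeasure_map (by fun_prop)
  rw [h4] at hF' ⊢
  rw [show (fun x => F (trieStep n x)) = F ∘ trieStep n from rfl,
    integral_prod _ hF', h1, integral_binomialMeasure hp hq hpq]
  congr 1
  ext k
  have e1 : μ k = P₁.map (fun x => x k) := by
    rw [hP₁, Measure.map_map (by fun_prop) (by fun_prop), ← h2 k]
    rfl
  have e2 : μ (n - k) = P₂.map (fun x => x (n - k)) := by
    rw [hP₂, Measure.map_map (by fun_prop) (by fun_prop), ← h3 (n - k)]
    rfl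
  rw [e1, e2, Measure.map_prod_map P₁ P₂ (measurable_pi_apply k) (measurable_pi_apply (n - k)),
    integral_map (by fun_prop) (measurable_of_countable _).aestronglyMeasurable]
  rfl

theorem IsTriePairFamily.integrable (hμ : IsTriePairFamily p μ) (n r : ℕ) {F : ℕ × ℕ → ℝ}
    (hF : ∀ x, |F x| ≤ ((x.1 : ℝ) + x.2) ^ r) : Integrable F (μ n) :=
  (hμ.moments n r).mono' (measurable_of_countable F).aestronglyMeasurable
    (Eventually.of_forall fun x => by simpa using hF x)

theorem IsTriePairFamily.mean_eq (hμ : IsTriePairFamily p μ) (hp : 0 ≤ p) (hq : 0 ≤ q)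
    (hpq : p + q = 1) {n : ℕ} (hn : 2 ≤ n) {u : ℕ × ℕ → ℝ} {s : ℝ}
    (hu : ∀ x, |u x| ≤ (x.1 : ℝ) + x.2)
    (hu' : ∀ x y : ℕ × ℕ, u (x.1 + y.1 + 1, x.2 + y.2 + n) = u x + u y + s) :
    ∫ x, u x ∂μ n = s + binE p q n (fun k => ∫ x, u x ∂μ k)
      + binE q p n (fun k => ∫ x, u x ∂μ k) := by
  have hi : ∀ k, Integrable u (μ k) := fun k => hμ.integrable k 1 (by simpa using hu)
  rw [hμ.integral_eq hp hq hpq hn (hi n), ← binE_reflect (p := p), ← binE_const hpq n s, ← binE_add,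
    ← binE_add]
  congr 1
  ext k
  have := hμ.prob
  simp only [hu']
  rw [integral_prod_add (hi _) (hi _)]
  ring

theorem IsTriePairFamily.covOf_eq (hμ : IsTriePairFamily p μ) (hp : 0 ≤ p) (hq : 0 ≤ q)
    (hpq : p + q = 1) {n : ℕ} (hn : 2 ≤ n) {u v : ℕ × ℕ → ℝ} {s t : ℝ}
    (hu : ∀ x, |u x| ≤ (x.1 : ℝ) + x.2) (hv : ∀ x, |v x| ≤ (x.1 : ℝ) + x.2)
    (hu' : ∀ x y : ℕ × ℕ, u (x.1 + y.1 + 1, x.2 + y.2 + n) = u x + u y + s)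
    (hv' : ∀ x y : ℕ × ℕ, v (x.1 + y.1 + 1, x.2 + y.2 + n) = v x + v y + t) :
    covOf (μ n) u v =
      binE p q n (fun k =>
        (∫ x, u x ∂μ k + ∫ x, u x ∂μ (n - k) + (s - ∫ x, u x ∂μ n)) *
        (∫ x, v x ∂μ k + ∫ x, v x ∂μ (n - k) + (t - ∫ x, v x ∂μ n)))
      + binE p q n (fun k => covOf (μ k) u v) + binE q p n (fun k => covOf (μ k) u v) := by
  have hiu : ∀ k, Integrable u (μ k) := fun k => hμ.integrable k 1 (by simpa using hu)
  have hiv : ∀ k, Integrable v (μ k) := fun k => hμ.integrable k 1 (by simpa using hv)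
  have hiuv : ∀ k, Integrable (fun x => u x * v x) (μ k) := fun k =>
    hμ.integrable k 2 fun x => by
      rw [abs_mul, pow_two]
      exact mul_le_mul (hu x) (hv x) (abs_nonneg _) (by positivity)
  have := hμ.prob
  have hF : Integrable (fun x => (u x - ∫ x, u x ∂μ n) * (v x - ∫ x, v x ∂μ n)) (μ n) := by
    set a := ∫ x, u x ∂μ n
    set b := ∫ x, v x ∂μ n
    rw [show (fun x => (u x - a) * (v x - b)) =
      fun x => ((u x * v x - b * u x) - a * v x) + a * b from funext fun x => by ring]
    exact (((hiuv n).sub ((hiu n).const_mul b)).sub ((hiv n).const_mul a)).add (integrable_const _)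
  rw [covOf, hμ.integral_eq hp hq hpq hn hF, ← binE_reflect (p := p), ← binE_add, ← binE_add]
  congr 1
  ext k
  rw [← sub_eq_zero]
  have h := integral_prod_add_mul_add (hiu k) (hiv k) (hiuv k) (hiu (n - k)) (hiv (n - k))
    (hiuv (n - k)) (s - ∫ x, u x ∂μ n) (t - ∫ x, v x ∂μ n)
  simp only [hu', hv', add_sub_assoc] at h ⊢
  rw [h]
  ring

end Recursion

section Toll

variable {p q : ℝ} {a b : ℕ → ℝ}

/-- The covariance of the conditional means of two additive functionals given the root split. -/
noncomputable def splitCov (p q : ℝ) (a b : ℕ → ℝ) (s t : ℝ) (n : ℕ) : ℝ :=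
  binE p q n (fun k => (a k + a (n - k) + (s - a n)) * (b k + b (n - k) + (t - b n)))

theorem splitCov_self_nonneg (hp : 0 ≤ p) (hq : 0 ≤ q) (s : ℝ) (n : ℕ) :
    0 ≤ splitCov p q a a s s n :=
  binE_nonneg hp hq fun _ _ => mul_self_nonneg _

theorem splitCov_self_eq (hpq : p + q = 1) {s : ℝ} {n : ℕ}
    (ha : a n = s + binE p q n a + binE q p n a) :
    splitCov p q a a s s n = binVar p q n (fun k => a k + a (n - k)) := by
  rw [binVar_eq hpq, binE_add, binE_reflect, splitCov]
  congr 1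
  ext k
  rw [ha]
  ring

theorem two_mul_abs_splitCov_le (hp : 0 ≤ p) (hq : 0 ≤ q) {l : ℝ} (hl : 0 < l) (s t : ℝ) (n : ℕ) :
    2 * |splitCov p q a b s t n| ≤
      l * splitCov p q a a s s n + 1 / l * splitCov p q b b t t n := by
  rw [splitCov, splitCov, splitCov, ← binE_mul_left, ← binE_mul_left, ← binE_add]
  refine (mul_le_mul_of_nonneg_left (abs_binE_le hp hq n _) zero_le_two).trans ?_
  rw [← binE_mul_left]
  refine binE_mono hp hq fun k _ => ?_
  set x := a k + a (n - k) + (s - a n)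
  set y := b k + b (n - k) + (t - b n)
  have h : l * (x * x) + 1 / l * (y * y) - 2 * (x * y) = 1 / l * (l * x - y) ^ 2 := by
    field_simp
    ring
  have h' : l * (x * x) + 1 / l * (y * y) + 2 * (x * y) = 1 / l * (l * x + y) ^ 2 := by
    field_simp
    ring
  have h1 : 0 ≤ 1 / l * (l * x - y) ^ 2 := by positivity
  have h2 : 0 ≤ 1 / l * (l * x + y) ^ 2 := by positivity
  rcases abs_cases (x * y) with ⟨e, _⟩ | ⟨e, _⟩ <;> rw [e] <;> linarith

theorem eq_toll_add_binE (h0 : a 0 = 0) (h1 : a 1 = 0) {t : ℕ → ℝ}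
    (ha : ∀ n, 2 ≤ n → a n = t n + binE p q n a + binE q p n a) (n : ℕ) :
    a n = (if 2 ≤ n then t n else 0) + 1 * binE p q n a + 1 * binE q p n a := by
  match n with
  | 0 => simp [binE_zero, h0]
  | 1 => simp [binE_succ, binE_zero, h0, h1]
  | n + 2 => simpa using ha (n + 2) (by omega)

theorem exists_flatSeq (hp : 0 < p) (hq : 0 < q) (hpq : p + q = 1) (h0 : a 0 = 0) (h1 : a 1 = 0)
    (ha : ∀ n, 2 ≤ n → a n = 1 + binE p q n a + binE q p n a) :
    ∃ D C, 2 * D ≤ C ∧ FlatSeq p q (fun n => a (n + 1) - a n) D C := by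
  have r0 := eq_toll_add_binE h0 h1 (t := fun _ => 1) ha
  have r1 := diff_recursion hpq r0
  simp only [one_mul] at r1
  have r2 := diff_recursion hpq r1
  have ht1 : ∀ n, 2 ≤ n → ((if 2 ≤ n + 1 then (1 : ℝ) else 0) - if 2 ≤ n then 1 else 0) = 0 :=
    fun n hn => by simp [hn, show 2 ≤ n + 1 by omega]
  obtain ⟨D, hD0, hD⟩ := exists_abs_le_of_recursion hp hq hpq ht1 r1
  obtain ⟨C, hC0, hC⟩ := exists_abs_le_div_of_recursion hp hq hpq
    (fun n hn => by simp only [ht1 n hn, ht1 (n + 1) (by omega), sub_zero]) r2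
  refine ⟨D, 4 * D + 2 * C, by linarith, hD, by positivity,
    fun x y hx hy => abs_floor_sub_le hD hC0 hC hx hy, fun n hn => ?_,
    tendsto_binE_sub_binE hp hq hpq (K := 2) hD fun n => ?_⟩
  · have := r1 n
    rw [ht1 n hn, zero_add] at this
    exact this
  · have e := r1 n
    rw [show (a (n + 1) - a n) - p * binE p q n (fun k => a (k + 1) - a k) -
      q * binE q p n (fun k => a (k + 1) - a k) = (if 2 ≤ n + 1 then (1 : ℝ) else 0) -
      if 2 ≤ n then 1 else 0 by linarith]
    match n with
    | 0 => norm_num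
    | 1 => norm_num
    | n + 2 =>
      rw [ht1 _ (by omega), abs_zero]
      positivity

theorem binE_split_diff (m : ℕ) (φ : ℝ → ℝ) :
    binE p q m (fun k => φ ((a (k + 1) + a (m + 1 - (k + 1))) - (a k + a (m + 1 - k)))) =
      binE p q m (fun k => φ ((a (k + 1) - a k) - (a (m - k + 1) - a (m - k)))) := by
  refine binE_congr fun k hk => ?_
  rw [show m + 1 - (k + 1) = m - k by omega, show m + 1 - k = m - k + 1 by omega]
  congr 1
  ring

theorem exists_splitCov_self_le (hp : 0 < p) (hq : 0 < q) (hpq : p + q = 1)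
    (ha : ∀ n, 2 ≤ n → a n = 1 + binE p q n a + binE q p n a) {d : ℕ → ℝ} {D C : ℝ}
    (hd : d = fun n => a (n + 1) - a n) (h : FlatSeq p q d D C) :
    ∃ c, 0 ≤ c ∧ ∀ n : ℕ, 2 ≤ n →
      splitCov p q a a 1 1 n ≤ c * (n * (d ⌊p * n⌋₊ - d ⌊q * n⌋₊) ^ 2 + 1) := by
  have hC := h.nonneg
  set B := C / (p * q) with hB
  have hB0 : 0 ≤ B := by positivity
  refine ⟨2 + 20 * B ^ 2, by positivity, fun n hn => ?_⟩
  obtain ⟨m, rfl⟩ : ∃ m, n = m + 1 := ⟨n - 1, by omega⟩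
  rw [splitCov_self_eq hpq (ha _ hn)]
  refine (binVar_le hp.le hq.le hpq m _).trans ?_
  rw [binE_split_diff m (fun x => x ^ 2)]
  set x : ℝ := ((m + 1 : ℕ) : ℝ) with hx
  have hxm : x = m + 1 := by simp [hx]
  have hx1 : 1 ≤ x := by rw [hxm]; linarith [Nat.cast_nonneg (α := ℝ) m]
  have hx0 : 0 < x := by linarith
  set δ := d ⌊p * x⌋₊ - d ⌊q * x⌋₊ with hδ
  have hpt : ∀ k ≤ m, ((a (k + 1) - a k) - (a (m - k + 1) - a (m - k))) ^ 2 ≤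
      2 * δ ^ 2 + 4 * (B / x) ^ 2 * (((k : ℝ) - m * p) ^ 2 + 4) := by
    intro k hk
    have e1 : a (k + 1) - a k = d k := by rw [hd]
    have e2 : a (m - k + 1) - a (m - k) = d (m - k) := by rw [hd]
    rw [e1, e2]
    have f1 := h.floor_le (p * x) k (by positivity) (Nat.cast_nonneg k)
    have f2 := h.floor_le (q * x) ((m - k : ℕ) : ℝ) (by positivity) (Nat.cast_nonneg _)
    rw [Nat.floor_natCast] at f1 f2
    set y := |(k : ℝ) - m * p| with hy
    have hy0 : 0 ≤ y := abs_nonneg _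
    have g1 : |(k : ℝ) - p * x| ≤ y + p := by
      rw [show (k : ℝ) - p * x = (k - m * p) - p by rw [hxm]; ring]
      exact (abs_sub _ _).trans (by rw [abs_of_pos hp])
    have g2 : |((m - k : ℕ) : ℝ) - q * x| ≤ y + q := by
      rw [show ((m - k : ℕ) : ℝ) - q * x = -(k - m * p) - q by
        rw [hxm, Nat.cast_sub hk]
        linear_combination (m : ℝ) * (-hpq)]
      exact (abs_sub _ _).trans (by rw [abs_neg, abs_of_pos hq])
    have key : ∀ r z : ℝ, 0 < r → r < 1 → z ≤ y + r →
        C * ((z + 1) / (r * x)) ≤ C / r * ((y + 2) / x) := fun r z hr hr1 hz => by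
      rw [show C * ((z + 1) / (r * x)) = C / r * ((z + 1) / x) by field_simp]
      gcongr ?_ * (?_ / x)
      linarith
    have k1 := f1.trans (key p _ hp (by linarith) g1)
    have k2 := f2.trans (key q _ hq (by linarith) g2)
    have k3 : |(d k - d (m - k)) - δ| ≤ B / x * (y + 2) := by
      rw [show (d k - d (m - k)) - δ = (d k - d ⌊p * x⌋₊) - (d (m - k) - d ⌊q * x⌋₊) by
        rw [hδ]; ring]
      refine (abs_sub _ _).trans ((add_le_add k1 k2).trans (le_of_eq ?_))
      rw [hB]
      field_simp
      linear_combination C * hpq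
    have k4 : ((d k - d (m - k)) - δ) ^ 2 ≤ (B / x) ^ 2 * (2 * (y ^ 2 + 4)) := by
      rw [← sq_abs]
      refine (pow_le_pow_left₀ (abs_nonneg _) k3 2).trans ?_
      rw [mul_pow]
      exact mul_le_mul_of_nonneg_left (by nlinarith [sq_nonneg (y - 2)]) (sq_nonneg _)
    rw [hy, sq_abs] at k4
    nlinarith [sq_nonneg ((d k - d (m - k)) - δ - δ)]
  have h1 := binE_mono hp.le hq.le hpt
  rw [binE_add, binE_const hpq, binE_mul_left, binE_add, binE_const hpq, binE_sq_dev hpq] at h1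
  have hpq1 : p * q ≤ 1 := by nlinarith
  have h2 : (m : ℝ) * p * q + 4 ≤ 5 * x := by
    rw [mul_assoc]
    have := mul_le_mul_of_nonneg_left hpq1 (Nat.cast_nonneg (α := ℝ) m)
    linarith
  have h3 : 4 * (B / x) ^ 2 * ((m : ℝ) * p * q + 4) ≤ 4 * (B / x) ^ 2 * (5 * x) := by gcongr
  have h4 : 4 * (B / x) ^ 2 * (5 * x) = 20 * B ^ 2 / x := by
    field_simp
    ring
  have h5 := h1.trans (add_le_add_right (h3.trans h4.le) _)
  rw [← hxm]
  have h6 : x * (p * q) ≤ x * 1 := by gcongr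
  calc _ ≤ x * (p * q) * (2 * δ ^ 2 + 20 * B ^ 2 / x) := by gcongr
    _ ≤ x * 1 * (2 * δ ^ 2 + 20 * B ^ 2 / x) := by gcongr
    _ = 2 * (x * δ ^ 2) + 20 * B ^ 2 := by field_simp
    _ ≤ _ := by
      have : 0 ≤ x * δ ^ 2 := by positivity
      nlinarith [sq_nonneg B, mul_nonneg (sq_nonneg B) this]

theorem splitCov_two_pos (hp : 0 < p) (hq : 0 < q) (hpq : p + q = 1) (h0 : a 0 = 0)
    (h1 : a 1 = 0) (ha : ∀ n, 2 ≤ n → a n = 1 + binE p q n a + binE q p n a) :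
    0 < splitCov p q a a 1 1 2 := by
  have e := ha 2 le_rfl
  rw [splitCov_self_eq hpq e]
  simp only [binE_succ, binE_zero, h0, h1] at e
  have h2 : a 2 ≠ 0 := by
    rintro h
    simp [h] at e
  have hv : binVar p q 2 (fun k => a k + a (2 - k)) = (p ^ 2 + q ^ 2) * (2 * (p * q)) * a 2 ^ 2 := by
    simp only [binVar, binE_succ, binE_zero]
    simp only [zero_add, Nat.reduceAdd, Nat.reduceSub, h0, h1, add_zero]
    obtain rfl : q = 1 - p := by linarith
    ring
  rw [hv]
  positivity

theorem exists_le_splitCov_self (hp : 0 < p) (hq : 0 < q) (hpq : p + q = 1) (hne : p ≠ q)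
    (h0 : b 0 = 0) (h1 : b 1 = 0)
    (hb : ∀ n : ℕ, 2 ≤ n → b n = n + binE p q n b + binE q p n b) :
    ∃ c, 0 < c ∧ ∃ N : ℕ, 2 ≤ N ∧ ∀ n : ℕ, N ≤ n → c * n ≤ splitCov p q b b n n n := by
  have r0 := eq_toll_add_binE h0 h1 (t := fun n => (n : ℝ)) hb
  have r1 := diff_recursion hpq r0
  simp only [one_mul] at r1
  have hlim := tendsto_binE_sub_binE_of_recursion hp hq hpq (fun n hn => by
    simp only [hn, show 2 ≤ n + 1 by omega, if_true]
    push_cast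
    ring) r1
  set L := (Real.log p - Real.log q) / (-(p * Real.log p) - q * Real.log q) with hL
  have hL0 : L ≠ 0 := by
    refine div_ne_zero (sub_ne_zero.2 fun h => hne ?_) (entropy_pos hp hq hpq).ne'
    exact Real.log_injOn_pos hp hq h
  have hL2 : 0 < L ^ 2 := by positivity
  obtain ⟨N, hN⟩ := eventually_atTop.1 ((hlim.pow 2).eventually_const_le (half_lt_self hL2))
  refine ⟨p * q * (L ^ 2 / 2), by positivity, N + 2, by omega, fun n hn => ?_⟩
  obtain ⟨m, rfl⟩ : ∃ m, n = m + 1 := ⟨n - 1, by omega⟩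
  rw [splitCov_self_eq hpq (hb _ (by omega))]
  refine le_trans ?_ (le_binVar hp.le hq.le hpq m _)
  rw [binE_split_diff m (fun x => x), binE_sub]
  rw [binE_reflect (p := p) (f := fun k => b (k + 1) - b k)]
  have := mul_le_mul_of_nonneg_left (hN m (by omega))
    (by positivity : 0 ≤ ((m : ℝ) + 1) * (p * q))
  push_cast
  linarith

end Toll

section Comparison

variable {p q : ℝ} {X V α β γ F : ℕ → ℝ} {M : ℕ}

theorem exists_abs_le_mul (h0 : X 0 = 0) (M : ℕ) : ∃ Γ, 0 ≤ Γ ∧ ∀ n ≤ M, |X n| ≤ Γ * n := by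
  have hΓ : 0 ≤ ∑ k ∈ Finset.range (M + 1), |X k| := Finset.sum_nonneg fun _ _ => abs_nonneg _
  refine ⟨_, hΓ, fun n hn => ?_⟩
  rcases Nat.eq_zero_or_pos n with rfl | hn0
  · simp [h0]
  have h1 := Finset.single_le_sum (f := fun k => |X k|) (fun k _ => abs_nonneg (X k))
    (Finset.mem_range.2 (by omega : n < M + 1))
  have h2 : (1 : ℝ) ≤ n := by exact_mod_cast hn0
  exact h1.trans (le_mul_of_one_le_right hΓ h2)

theorem abs_le_of_recursion (hp : 0 < p) (hq : 0 < q) (hpq : p + q = 1) (hM : 2 ≤ M)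
    (hF0 : ∀ n, 0 ≤ F n) (hF : ∀ n, M ≤ n → binE p q n F + binE q p n F + α n ≤ F n)
    (hV0 : ∀ n, 0 ≤ V n) (hV : ∀ n, 2 ≤ n → V n = β n + binE p q n V + binE q p n V)
    (hX : ∀ n, 2 ≤ n → X n = γ n + binE p q n X + binE q p n X)
    {Γ : ℝ} (hΓ : ∀ n ≤ M, |X n| ≤ Γ * n) {l : ℝ} (hl : 0 < l)
    (hγ : ∀ n, 2 * |γ n| ≤ l * α n + 1 / l * β n) (n : ℕ) :
    |X n| ≤ l / 2 * F n + 1 / l / 2 * V n + Γ * n := by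
  have hqp : q + p = 1 := by linarith
  suffices h : |X n| - l / 2 * F n - 1 / l / 2 * V n - Γ * n ≤ 0 by linarith
  refine nonpos_of_le_binE (p := p) (q := q) (c₁ := 1) (c₂ := 1) (M := M)
    (w := fun n => |X n| - l / 2 * F n - 1 / l / 2 * V n - Γ * n) hp.le hq.le zero_le_one
    zero_le_one (fun n hn => ?_) (fun n hn => ?_) (fun n hn => ?_) n
  · simpa using pow_add_pow_lt_one hp hq hpq (by omega : 2 ≤ n)
  · have h1 : 0 ≤ l / 2 * F n := mul_nonneg (by positivity) (hF0 n)
    have h2 : 0 ≤ 1 / l / 2 * V n := mul_nonneg (by positivity) (hV0 n)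
    linarith [hΓ n hn]
  · simp only [binE_sub, binE_mul_left, binE_id hpq, binE_id hqp]
    have h1 : |X n| ≤ |γ n| + binE p q n (fun k => |X k|) + binE q p n (fun k => |X k|) := by
      rw [hX n (by omega)]
      exact (abs_add_three _ _ _).trans (add_le_add_three le_rfl (abs_binE_le hp.le hq.le n X)
        (abs_binE_le hq.le hp.le n X))
    have h2 := mul_le_mul_of_nonneg_left (hF n hn.le) (by positivity : 0 ≤ l / 2)
    have h3 := hV n (by omega)
    linear_combination h1 + h2 + hγ n / 2 - 1 / l / 2 * h3 + Γ * n * hpq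

theorem tendsto_div_sqrt_zero {S : ℕ → ℝ} {c : ℝ} (hc : 0 < c)
    (hS : ∀ n : ℕ, 2 ≤ n → c * n ≤ S n)
    (hV : ∀ A : ℝ, ∃ M : ℕ, ∀ n : ℕ, M ≤ n → A * n ≤ V n)
    (hX : ∀ ε : ℝ, 0 < ε → ∃ (M : ℕ) (Γ : ℝ), 0 ≤ Γ ∧ ∀ n : ℕ, M ≤ n → ∀ l : ℝ, 0 < l →
      |X n| ≤ l / 2 * (ε * n) + 1 / l / 2 * V n + Γ * n) :
    Tendsto (fun n => X n / √(S n * V n)) atTop (𝓝 0) := by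
  rw [Metric.tendsto_atTop]
  intro η hη
  set σ := √c with hσ
  have hσ0 : 0 < σ := Real.sqrt_pos.2 hc
  obtain ⟨M₁, Γ, hΓ, hX⟩ := hX ((η * σ / 4) ^ 2) (by positivity)
  obtain ⟨M₂, hV⟩ := hV ((4 * Γ / (η * σ)) ^ 2 + 1)
  refine ⟨max (max M₁ M₂) 2, fun n hn => ?_⟩
  simp only [max_le_iff] at hn
  obtain ⟨⟨hn1, hn2⟩, hn3⟩ := hn
  have hn0 : (0 : ℝ) < n := by exact_mod_cast (by omega : 0 < n)
  have hVn := hV n hn2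
  have hV1 : (4 * Γ / (η * σ)) ^ 2 + 1 ≤ V n / n := by rwa [le_div_iff₀ hn0]
  set t := √(V n / n) with ht
  have ht2 : t ^ 2 = V n / n := Real.sq_sqrt (by nlinarith [sq_nonneg (4 * Γ / (η * σ))])
  have hVt : V n = n * t ^ 2 := by rw [ht2]; field_simp
  have ht0 : 0 < t := Real.sqrt_pos.2 (by nlinarith [sq_nonneg (4 * Γ / (η * σ))])
  have htΓ : 4 * Γ / (η * σ) ≤ t := Real.le_sqrt_of_sq_le (by linarith)
  have htΓ' : Γ ≤ η * σ / 4 * t := by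
    rw [div_le_iff₀ (by positivity)] at htΓ
    linarith
  have h1 := hX n hn1 (t / (η * σ / 4)) (by positivity)
  have e1 : t / (η * σ / 4) / 2 * ((η * σ / 4) ^ 2 * n) = η * σ / 8 * t * n := by
    field_simp
    norm_num
  have e2 : 1 / (t / (η * σ / 4)) / 2 * V n = η * σ / 8 * t * n := by
    rw [hVt]
    field_simp
    norm_num
  have h2 := mul_le_mul_of_nonneg_right htΓ' hn0.le
  have h3 : σ * (n * t) ≤ √(S n * V n) := by
    refine Real.le_sqrt_of_sq_le ?_
    have h4 := mul_le_mul_of_nonneg_right (hS n hn3) (by rw [hVt]; positivity : 0 ≤ V n)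
    refine le_trans (le_of_eq ?_) h4
    rw [mul_pow, hσ, Real.sq_sqrt hc.le, hVt]
    ring
  have h5 : 0 < σ * (n * t) := by positivity
  have h6 : 0 < √(S n * V n) := h5.trans_le h3
  rw [Real.dist_eq, sub_zero, abs_div, abs_of_pos h6, div_lt_iff₀ h6]
  have h7 := mul_le_mul_of_nonneg_left h3 hη.le
  have h8 : 0 < η * (σ * (n * t)) := by positivity
  rw [e1, e2] at h1
  linarith

end Comparison

/-- for `p ≠ 1/2`, the correlation coefficient `ρ(S_n, K_n)` tends to `0`. -/
theorem stmt0 (p : ℝ) (hp0 : 0 < p) (hp1 : p < 1) (hp : p ≠ 1 / 2)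
    (μ : ℕ → Measure (ℕ × ℕ)) (hμ : IsTriePairFamily p μ) :
    Tendsto (fun n : ℕ => covSK μ n / Real.sqrt (varS μ n * varK μ n)) atTop (𝓝 0) := by
  obtain ⟨q, hpq⟩ : ∃ q, p + q = 1 := ⟨1 - p, by ring⟩
  have hq0 : 0 < q := by linarith
  have hne : p ≠ q := fun h => hp (by linarith)
  have hu : ∀ x : ℕ × ℕ, |(x.1 : ℝ)| ≤ (x.1 : ℝ) + x.2 := fun x => by
    rw [Nat.abs_cast]
    exact le_add_of_nonneg_right (Nat.cast_nonneg _)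
  have hv : ∀ x : ℕ × ℕ, |(x.2 : ℝ)| ≤ (x.1 : ℝ) + x.2 := fun x => by
    rw [Nat.abs_cast]
    exact le_add_of_nonneg_left (Nat.cast_nonneg _)
  have hu' : ∀ (n : ℕ) (x y : ℕ × ℕ), (((x.1 + y.1 + 1, x.2 + y.2 + n) : ℕ × ℕ).1 : ℝ) =
      (x.1 : ℝ) + y.1 + 1 := fun n x y => by push_cast; rfl
  have hv' : ∀ (n : ℕ) (x y : ℕ × ℕ), (((x.1 + y.1 + 1, x.2 + y.2 + n) : ℕ × ℕ).2 : ℝ) =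
      (x.2 : ℝ) + y.2 + n := fun n x y => by push_cast; rfl
  have hS0 : eS μ 0 = 0 := by simp [eS, hμ.init0]
  have hS1 : eS μ 1 = 0 := by simp [eS, hμ.init1]
  have hK0 : eK μ 0 = 0 := by simp [eK, hμ.init0]
  have hK1 : eK μ 1 = 0 := by simp [eK, hμ.init1]
  have hX0 : covSK μ 0 = 0 := by simp [covSK, hS0, hμ.init0]
  have hvS0 : ∀ n, 0 ≤ varS μ n := fun n => integral_nonneg fun _ => sq_nonneg _
  have hvK0 : ∀ n, 0 ≤ varK μ n := fun n => integral_nonneg fun _ => sq_nonneg _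
  have evS : varS μ = fun n => covOf (μ n) (fun x => (x.1 : ℝ)) (fun x => (x.1 : ℝ)) :=
    funext fun n => by simp only [varS, covOf, pow_two, eS]
  have evK : varK μ = fun n => covOf (μ n) (fun x => (x.2 : ℝ)) (fun x => (x.2 : ℝ)) :=
    funext fun n => by simp only [varK, covOf, pow_two, eK]
  have hS : ∀ n, 2 ≤ n → eS μ n = 1 + binE p q n (eS μ) + binE q p n (eS μ) :=
    fun n hn => hμ.mean_eq hp0.le hq0.le hpq hn hu (hu' n)
  have hK : ∀ n : ℕ, 2 ≤ n → eK μ n = n + binE p q n (eK μ) + binE q p n (eK μ) :=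
    fun n hn => hμ.mean_eq hp0.le hq0.le hpq hn hv (hv' n)
  have hvS : ∀ n, 2 ≤ n → varS μ n = splitCov p q (eS μ) (eS μ) 1 1 n +
      binE p q n (varS μ) + binE q p n (varS μ) := fun n hn => by
    rw [evS]
    exact hμ.covOf_eq hp0.le hq0.le hpq hn hu hu (hu' n) (hu' n)
  have hvK : ∀ n, 2 ≤ n → varK μ n = splitCov p q (eK μ) (eK μ) n n n +
      binE p q n (varK μ) + binE q p n (varK μ) := fun n hn => by
    rw [evK]
    exact hμ.covOf_eq hp0.le hq0.le hpq hn hv hv (hv' n) (hv' n)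
  have hX : ∀ n, 2 ≤ n → covSK μ n = splitCov p q (eS μ) (eK μ) 1 n n +
      binE p q n (covSK μ) + binE q p n (covSK μ) := fun n hn =>
    hμ.covOf_eq hp0.le hq0.le hpq hn hu hv (hu' n) (hv' n)
  obtain ⟨c, hc, hlin⟩ := exists_linear_le hp0 hq0 hpq hvS0 (by
    have h1 := splitCov_two_pos hp0 hq0 hpq hS0 hS1 hS
    have h2 := binE_nonneg hp0.le hq0.le (n := 2) fun k _ => hvS0 k
    have h3 := binE_nonneg hq0.le hp0.le (n := 2) fun k _ => hvS0 k
    linarith [hvS 2 le_rfl]) fun n hn => by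
      linarith [hvS n hn, splitCov_self_nonneg (a := eS μ) hp0.le hq0.le 1 n]
  obtain ⟨c', hc', N, hN, hβ⟩ := exists_le_splitCov_self hp0 hq0 hpq hne hK0 hK1 hK
  obtain ⟨D, C, hDC, hflat⟩ := exists_flatSeq hp0 hq0 hpq hS0 hS1 hS
  obtain ⟨c₁, hc₁, hα⟩ := exists_splitCov_self_le hp0 hq0 hpq hS rfl hflat
  refine tendsto_div_sqrt_zero hc hlin (exists_forall_mul_le hp0 hq0 hpq hvK0 hc' (N := N)
    fun n hn => by linarith [hvK n (hN.trans hn), hβ n hn]) fun ε hε => ?_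
  obtain ⟨M, F, hM, hF0, hFε, hF⟩ := hflat.exists_majorant hp0 hq0 hpq hDC hc₁ hα hε
  obtain ⟨Γ, hΓ0, hΓ⟩ := exists_abs_le_mul hX0 M
  refine ⟨M, Γ, hΓ0, fun n hn l hl => ?_⟩
  have h1 := abs_le_of_recursion hp0 hq0 hpq hM hF0 hF hvK0 hvK hX hΓ hl
    (fun n => two_mul_abs_splitCov_le hp0.le hq0.le hl 1 n n) n
  have h2 := mul_le_mul_of_nonneg_left (hFε n hn) (by positivity : 0 ≤ l / 2)
  linarith
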